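/- Let M ≥ 1 and p ∈ (0,1)^M, let (Y_n)_{n≥0} be a standard excited random walk with M cookies and cookie strength vector p, and let (Z_n)_{n≥0} be the associated backwards branching-like process (with p_0 = 1/2). Then: (i) the chain (Z_n) has a stationary distribution π if and only if δ(M,p) > 1; and (ii) if δ(M,p) > 1, then almost surely lim_{n→∞} Y_n / n = 1 / (1 + 2 ∑_{k≥0} k π(k)), with the convention that 1/(+∞) = 0 when ∑_{k≥0} k π(k) = ∞. -/

import Mathlib

open MeasureTheory ProbabilityTheory Filter Topology
open scoped ENNReal NNReal

/-- The success probability of the `j+1`-st visit to a site: `p (j+1)` while cookies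
remain (`j < M`), and the bias parameter `p₀` afterwards. -/
noncomputable def cookieSeq (M : ℕ) (p : Fin M → ℝ) (p₀ : ℝ) (j : ℕ) : ℝ :=
  if h : j < M then p ⟨j, h⟩ else p₀

/-- `IsEARW P M p p₀ X` : under the probability measure `P`, the process `X` is an
excited asymmetric random walk with `M` cookies of strengths `p ∈ (0,1)^M` and bias
parameter `p₀`: it starts at `0`, moves by `±1` steps, and conditionally on the path
`(X 0, …, X n)` it steps right with probability `p i` on the event
`#{m ≤ n : X m = X n} = i` for `1 ≤ i ≤ M`, and with probability `p₀` on the event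
`#{m ≤ n : X m = X n} > M`. -/
structure IsEARW {Ω : Type*} [MeasurableSpace Ω] (P : Measure Ω)
    (M : ℕ) (p : Fin M → ℝ) (p₀ : ℝ) (X : ℕ → Ω → ℤ) : Prop where
  measurable : ∀ n, Measurable (X n)
  init : ∀ ω, X 0 ω = 0
  steps : ∀ ω n, |X (n + 1) ω - X n ω| = 1
  cond : ∀ (n : ℕ) (w : Fin (n + 1) → ℤ),
    P ({ω | X (n + 1) ω = w (Fin.last n) + 1} ∩ {ω | ∀ m : Fin (n + 1), X m ω = w m})
      = ENNReal.ofReal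
          (cookieSeq M p p₀
            ((Finset.univ.filter fun m : Fin (n + 1) => w m = w (Fin.last n)).card - 1))
        * P {ω | ∀ m : Fin (n + 1), X m ω = w m}


/-- `bbTrans q l m` is the transition probability `p(l,m) = P(A (l+1) = m)` of the
backwards branching-like process: the probability that in a sequence of independent
Bernoulli trials whose `j`-th trial succeeds with probability `q j` (`j` 0-indexed),
there are exactly `m` failures before the `(l+1)`-st success.  Equivalently, among the
first `m + l` trials there are exactly `l` successes and trial `m + l` is a success. -/
noncomputable def bbTrans (q : ℕ → ℝ) (l m : ℕ) : ℝ :=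
  (∑ s ∈ Finset.univ.filter
      (fun s : Fin (m + l) → Bool =>
        (Finset.univ.filter fun j => s j = true).card = l),
    ∏ j : Fin (m + l), (if s j then q (j : ℕ) else 1 - q (j : ℕ)))
    * q (m + l)

/-- `IsStationaryDist q π` : `π` is a stationary distribution of the backwards
branching-like process with transition probabilities `bbTrans q`: a probability mass
function on `ℕ` with `π m = ∑' l, π l * p(l,m)` for all `m`. -/
def IsStationaryDist (q : ℕ → ℝ) (π : ℕ → ℝ) : Prop :=
  (∀ k, 0 ≤ π k) ∧ (∑' k, π k) = 1 ∧ ∀ m, π m = ∑' l, π l * bbTrans q l m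

/-- The probability of exactly `l` successes among the first `N` trials. -/
noncomputable def succWeight (q : ℕ → ℝ) (N l : ℕ) : ℝ :=
  ∑ s ∈ Finset.univ.filter
      (fun s : Fin N → Bool => (Finset.univ.filter fun j => s j = true).card = l),
    ∏ j : Fin N, (if s j then q (j : ℕ) else 1 - q (j : ℕ))

lemma bbTrans_eq (q : ℕ → ℝ) (l m : ℕ) :
    bbTrans q l m = succWeight q (m + l) l * q (m + l) := rfl

lemma succWeight_zero_left (q : ℕ → ℝ) (l : ℕ) :
    succWeight q 0 l = if l = 0 then 1 else 0 := by
  rw [succWeight, Finset.sum_filter]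
  cases l <;> simp

lemma succWeight_succ (q : ℕ → ℝ) (N l : ℕ) :
    succWeight q (N + 1) l =
      (if l = 0 then 0 else q 0 * succWeight (fun j => q (j + 1)) N (l - 1))
        + (1 - q 0) * succWeight (fun j => q (j + 1)) N l := by
  simp only [succWeight, Finset.sum_filter]
  rw [← (Fin.consEquiv (fun _ : Fin (N + 1) => Bool)).sum_comp, Fintype.sum_prod_type]
  simp only [Fintype.sum_bool, Fin.consEquiv_apply, Finset.card_filter, Fin.sum_univ_succ,
    Fin.cons_zero, Fin.cons_succ, Fin.prod_univ_succ, Finset.mul_sum]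
  congr 1
  · cases l with
    | zero => simp
    | succ k =>
      rw [if_neg (Nat.succ_ne_zero k)]
      refine Finset.sum_congr rfl fun s _ => ?_
      simp [add_comm 1]
  · refine Finset.sum_congr rfl fun s _ => ?_
    simp

lemma succWeight_eq_zero {q : ℕ → ℝ} {N l : ℕ} (h : N < l) : succWeight q N l = 0 := by
  induction N generalizing q l with
  | zero => rw [succWeight_zero_left, if_neg (by omega)]
  | succ N ih => rw [succWeight_succ, if_neg (by omega), ih (by omega), ih (by omega)]; simp

lemma bbTrans_zero_zero (q : ℕ → ℝ) : bbTrans q 0 0 = q 0 := by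
  simp [bbTrans_eq, succWeight_zero_left]

lemma bbTrans_zero_succ (q : ℕ → ℝ) (m : ℕ) :
    bbTrans q 0 (m + 1) = (1 - q 0) * bbTrans (fun j => q (j + 1)) 0 m := by
  simp [bbTrans_eq, succWeight_succ, mul_assoc]

lemma bbTrans_succ_zero (q : ℕ → ℝ) (l : ℕ) :
    bbTrans q (l + 1) 0 = q 0 * bbTrans (fun j => q (j + 1)) l 0 := by
  simp [bbTrans_eq, succWeight_succ, mul_assoc, succWeight_eq_zero]

lemma bbTrans_succ_succ (q : ℕ → ℝ) (l m : ℕ) :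
    bbTrans q (l + 1) (m + 1) = q 0 * bbTrans (fun j => q (j + 1)) l (m + 1)
      + (1 - q 0) * bbTrans (fun j => q (j + 1)) (l + 1) m := by
  have h1 : m + 1 + (l + 1) = (m + 1 + l) + 1 := by ring
  have h2 : m + (l + 1) = m + 1 + l := by ring
  simp only [bbTrans_eq, h1, h2, succWeight_succ]
  simp
  ring

/-- The law of the number of failures before the `k`-th success, for every `k ≥ 0`. -/
noncomputable def failLaw (q : ℕ → ℝ) : ℕ → ℕ → ℝ
  | 0, m => if m = 0 then 1 else 0
  | l + 1, m => bbTrans q l m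

lemma failLaw_succ_zero (q : ℕ → ℝ) (k : ℕ) :
    failLaw q (k + 1) 0 = q 0 * failLaw (fun j => q (j + 1)) k 0 := by
  cases k with
  | zero => simp [failLaw, bbTrans_zero_zero]
  | succ k => simp [failLaw, bbTrans_succ_zero]

lemma failLaw_succ_succ (q : ℕ → ℝ) (k m : ℕ) :
    failLaw q (k + 1) (m + 1) = q 0 * failLaw (fun j => q (j + 1)) k (m + 1)
      + (1 - q 0) * failLaw (fun j => q (j + 1)) (k + 1) m := by
  cases k with
  | zero => simp [failLaw, bbTrans_zero_succ]
  | succ k => simp [failLaw, bbTrans_succ_succ]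

lemma hasSum_failLaw_succ {q : ℕ → ℝ} {k : ℕ} {h : ℕ → ℝ} {a b : ℝ}
    (ha : HasSum (fun m => h m * failLaw (fun j => q (j + 1)) k m) a)
    (hb : HasSum (fun m => h (m + 1) * failLaw (fun j => q (j + 1)) (k + 1) m) b) :
    HasSum (fun m => h m * failLaw q (k + 1) m) (q 0 * a + (1 - q 0) * b) := by
  rw [hasSum_nat_add_iff' 1 |>.symm] at ha ⊢
  have := (ha.mul_left (q 0)).add (hb.mul_left (1 - q 0))
  convert! this using 1
  · ext m
    rw [failLaw_succ_succ]; ring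
  · simp [failLaw_succ_zero]; ring

lemma succWeight_half (N l : ℕ) :
    succWeight (fun _ => 1 / 2) N l = (N.choose l : ℝ) * (1 / 2) ^ N := by
  induction N generalizing l with
  | zero => cases l <;> simp [succWeight_zero_left]
  | succ N ih =>
    rw [succWeight_succ, ih, ih]
    cases l with
    | zero => simp; ring
    | succ l => simp [Nat.choose_succ_succ]; ring

lemma hasSum_choose_half (k : ℕ) :
    HasSum (fun m : ℕ => ((m + k).choose k : ℝ) * (1 / 2) ^ (m + k + 1)) 1 := by
  have := (hasSum_choose_mul_geometric_of_norm_lt_one (𝕜 := ℝ) k (r := 1 / 2)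
    (by norm_num)).mul_right ((1 / 2) ^ (k + 1))
  convert! this using 1
  · ext m; ring
  · field_simp; norm_num

lemma failLaw_half_succ (l m : ℕ) :
    failLaw (fun _ => 1 / 2) (l + 1) m = ((m + l).choose l : ℝ) * (1 / 2) ^ (m + l + 1) := by
  simp only [failLaw, bbTrans_eq, succWeight_half]; ring

lemma hasSum_mul_failLaw_half (k : ℕ) :
    HasSum (fun m : ℕ => (m : ℝ) * failLaw (fun _ => 1 / 2) k m) k := by
  cases k with
  | zero =>
    convert! hasSum_zero (α := ℝ) (β := ℕ) using 1
    · ext m; cases m <;> simp [failLaw]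
    · simp
  | succ l =>
    rw [← hasSum_nat_add_iff' 1]
    have := (hasSum_choose_half (l + 1)).mul_right ((l + 1 : ℕ) : ℝ)
    convert! this using 1
    · ext m
      have h : ((m + 1 + l).choose l : ℝ) * ((m : ℝ) + 1)
          = ((m + (l + 1)).choose (l + 1) : ℝ) * (l + 1) := by
        have := Nat.choose_succ_right_eq (m + 1 + l) l
        have e : m + 1 + l - l = m + 1 := by omega
        rw [e] at this
        have e2 : m + (l + 1) = m + 1 + l := by ring
        rw [e2]; exact_mod_cast this.symm
      rw [failLaw_half_succ]
      push_cast
      have e3 : m + 1 + l + 1 = m + (l + 1) + 1 := by ring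
      rw [e3]
      linear_combination (1 / 2 : ℝ) ^ (m + (l + 1) + 1) * h
    · simp

lemma hasSum_mul_mul_failLaw_half (k : ℕ) :
    HasSum (fun m : ℕ => (m : ℝ) * (m - 1) * failLaw (fun _ => 1 / 2) k m) (k * (k + 1)) := by
  cases k with
  | zero =>
    convert! hasSum_zero (α := ℝ) (β := ℕ) using 1
    · ext m; cases m <;> simp [failLaw]
    · simp
  | succ l =>
    rw [← hasSum_nat_add_iff' 2]
    have := (hasSum_choose_half (l + 2)).mul_right (((l + 1 : ℕ) : ℝ) * ((l + 1 : ℕ) + 1))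
    convert! this using 1
    · ext m
      have h : ((m + 2 + l).choose l : ℝ) * ((m : ℝ) + 2) 
          = ((m + (l + 2)).choose (l + 1) : ℝ) * (l + 1) := by
        have := Nat.choose_succ_right_eq (m + 2 + l) l
        have e : m + 2 + l - l = m + 2 := by omega
        rw [e] at this
        have e2 : m + (l + 2) = m + 2 + l := by ring
        rw [e2]; exact_mod_cast this.symm
      have h' : ((m + (l + 2)).choose (l + 1) : ℝ) * ((m : ℝ) + 1)
          = ((m + (l + 2)).choose (l + 2) : ℝ) * (l + 2) := by
        have := Nat.choose_succ_right_eq (m + (l + 2)) (l + 1)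
        have e : m + (l + 2) - (l + 1) = m + 1 := by omega
        rw [e] at this
        exact_mod_cast this.symm
      rw [failLaw_half_succ]
      push_cast
      have e3 : m + 2 + l + 1 = m + (l + 2) + 1 := by ring
      rw [e3]
      linear_combination (1 / 2 : ℝ) ^ (m + (l + 2) + 1) * ((m + 1) * h + (l + 1) * h')
    · simp [Finset.sum_range_succ]

lemma bbTrans_pos {q : ℕ → ℝ} (hq : ∀ j, q j ∈ Set.Ioo (0 : ℝ) 1) (l m : ℕ) :
    0 < bbTrans q l m := by
  induction l generalizing q m with
  | zero =>
    induction m generalizing q with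
    | zero => rw [bbTrans_zero_zero]; exact (hq 0).1
    | succ m ih =>
      rw [bbTrans_zero_succ]
      exact mul_pos (by linarith [(hq 0).2]) (ih fun j => hq (j + 1))
  | succ l ihl =>
    induction m generalizing q with
    | zero =>
      rw [bbTrans_succ_zero]
      exact mul_pos (hq 0).1 (ihl (fun j => hq (j + 1)) _)
    | succ m ih =>
      rw [bbTrans_succ_succ]
      have h1 := mul_pos (hq 0).1 (ihl (fun j => hq (j + 1)) (m + 1))
      have h2 := mul_pos (sub_pos.2 (hq 0).2) (ih fun j => hq (j + 1))
      exact add_pos h1 h2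

lemma failLaw_nonneg {q : ℕ → ℝ} (hq : ∀ j, q j ∈ Set.Ioo (0 : ℝ) 1) (k m : ℕ) :
    0 ≤ failLaw q k m := by
  cases k with
  | zero => simp only [failLaw]; split_ifs <;> norm_num
  | succ l => exact (bbTrans_pos hq l m).le

lemma hasSum_failLaw {M : ℕ} {q : ℕ → ℝ} (hM : ∀ j, M ≤ j → q j = 1 / 2) (k : ℕ) :
    HasSum (failLaw q k) 1 := by
  induction M generalizing q k with
  | zero =>
    obtain rfl : q = fun _ => 1 / 2 := funext fun j => hM j (Nat.zero_le j)
    cases k with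
    | zero => exact hasSum_ite_eq 0 1
    | succ l =>
      convert! hasSum_choose_half l using 1
      ext m
      rw [failLaw_half_succ]
  | succ M ih =>
    cases k with
    | zero => exact hasSum_ite_eq 0 1
    | succ k =>
      have hq' : ∀ j, M ≤ j → q (j + 1) = 1 / 2 := fun j hj => hM _ (by omega)
      have := hasSum_failLaw_succ (q := q) (k := k) (h := fun _ => 1) (a := 1) (b := 1)
        (by simpa using ih hq' k) (by simpa using ih hq' (k + 1))
      simpa using this

lemma exists_hasSum_mul_failLaw {M : ℕ} {q : ℕ → ℝ} (hM : ∀ j, M ≤ j → q j = 1 / 2) (k : ℕ) :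
    ∃ e, HasSum (fun m : ℕ => (m : ℝ) * failLaw q k m) e ∧
      (M ≤ k → e = k - ∑ j ∈ Finset.range M, (2 * q j - 1)) := by
  induction M generalizing q k with
  | zero =>
    obtain rfl : q = fun _ => 1 / 2 := funext fun j => hM j (Nat.zero_le j)
    exact ⟨k, hasSum_mul_failLaw_half k, by simp⟩
  | succ M ih =>
    have hq' : ∀ j, M ≤ j → q (j + 1) = 1 / 2 := fun j hj => hM _ (by omega)
    cases k with
    | zero =>
      refine ⟨0, ?_, by omega⟩
      convert! hasSum_zero (α := ℝ) (β := ℕ) using 1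
      ext m; cases m <;> simp [failLaw]
    | succ k =>
      obtain ⟨a, ha, ha'⟩ := ih hq' k
      obtain ⟨b, hb, hb'⟩ := ih hq' (k + 1)
      have hb1 := hb.add (hasSum_failLaw hq' (k + 1))
      refine ⟨_, hasSum_failLaw_succ (b := b + 1) ha ?_, fun hk => ?_⟩
      · convert! hb1 using 1
        ext m
        push_cast
        ring
      · rw [ha' (by omega), hb' (by omega), Finset.sum_range_succ']
        push_cast
        ring

lemma exists_hasSum_sq_failLaw {M : ℕ} {q : ℕ → ℝ} (hq : ∀ j, q j ∈ Set.Ioo (0 : ℝ) 1)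
    (hM : ∀ j, M ≤ j → q j = 1 / 2) :
    ∃ C, 0 ≤ C ∧ ∀ k, ∃ v, HasSum (fun m : ℕ => ((m : ℝ) - k) ^ 2 * failLaw q k m) v ∧
      v ≤ C * (k + 1) := by
  induction M generalizing q with
  | zero =>
    obtain rfl : q = fun _ => 1 / 2 := funext fun j => hM j (Nat.zero_le j)
    refine ⟨2, by norm_num, fun k => ⟨k * (k + 1) + k - (2 * k) * k + (k : ℝ) ^ 2 * 1, ?_, ?_⟩⟩
    · convert! (((hasSum_mul_mul_failLaw_half k).add (hasSum_mul_failLaw_half k)).sub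
        ((hasSum_mul_failLaw_half k).mul_left (2 * (k : ℝ)))).add
        ((hasSum_failLaw hM k).mul_left ((k : ℝ) ^ 2)) using 1
      ext m
      ring
    · linarith
  | succ M ih =>
    have hq' : ∀ j, M ≤ j → q (j + 1) = 1 / 2 := fun j hj => hM _ (by omega)
    have hq1 : ∀ j, q (j + 1) ∈ Set.Ioo (0 : ℝ) 1 := fun j => hq (j + 1)
    obtain ⟨C, hC, h⟩ := ih hq1 hq'
    refine ⟨4 * C + 4, by linarith, fun k => ?_⟩
    cases k with
    | zero =>
      refine ⟨0, ?_, by push_cast; linarith⟩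
      convert! hasSum_zero (α := ℝ) (β := ℕ) using 1
      ext m; cases m <;> simp [failLaw]
    | succ k =>
      obtain ⟨a, ha, ha'⟩ := h k
      obtain ⟨b, hb, hb'⟩ := h (k + 1)
      obtain ⟨e, he, -⟩ := exists_hasSum_mul_failLaw hq' k
      obtain ⟨e', he', -⟩ := exists_hasSum_mul_failLaw hq' (k + 1)
      have h0 := hasSum_failLaw hq' k
      have h0' := hasSum_failLaw hq' (k + 1)
      have hA : HasSum (fun m : ℕ => ((m : ℝ) - (k + 1 : ℕ)) ^ 2
          * failLaw (fun j => q (j + 1)) k m) (a - 2 * e + (2 * k + 1) * 1) := by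
        convert! (ha.sub (he.mul_left 2)).add (h0.mul_left (2 * (k : ℝ) + 1)) using 1
        ext m; push_cast; ring
      have hB : HasSum (fun m : ℕ => (((m + 1 : ℕ) : ℝ) - (k + 1 : ℕ)) ^ 2
          * failLaw (fun j => q (j + 1)) (k + 1) m) (b + 2 * e' - (2 * k + 1) * 1) := by
        convert! (hb.add (he'.mul_left 2)).sub (h0'.mul_left (2 * (k : ℝ) + 1)) using 1
        ext m; push_cast; ring
      refine ⟨_, hasSum_failLaw_succ hA hB, ?_⟩
      have hA2 := hasSum_le (fun m => ?_) hA ((ha.mul_left 2).add (h0.mul_left 2))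
      have hB2 := hasSum_le (fun m => ?_) hB ((hb.mul_left 2).add (h0'.mul_left 2))
      · have q0 := hq 0
        push_cast at ha' hb' ⊢
        have hk : (0 : ℝ) ≤ k := k.cast_nonneg
        have x1 : (a - 2 * e + (2 * k + 1) * 1) ≤ (4 * C + 4) * (k + 1 + 1) := by nlinarith
        have x2 : (b + 2 * e' - (2 * k + 1) * 1) ≤ (4 * C + 4) * (k + 1 + 1) := by nlinarith
        have := mul_le_mul_of_nonneg_left x1 q0.1.le
        have := mul_le_mul_of_nonneg_left x2 (sub_nonneg.2 q0.2.le)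
        linarith
      · rw [← mul_assoc, ← add_mul]
        refine mul_le_mul_of_nonneg_right ?_ (failLaw_nonneg hq1 _ _)
        push_cast
        nlinarith [sq_nonneg ((m : ℝ) - k - 2)]
      · rw [← mul_assoc, ← add_mul]
        refine mul_le_mul_of_nonneg_right ?_ (failLaw_nonneg hq1 _ _)
        push_cast
        nlinarith [sq_nonneg ((m : ℝ) - k + 1)]

lemma IsStationaryDist.summable {q π : ℕ → ℝ} (h : IsStationaryDist q π) : Summable π := by
  by_contra hs
  have := h.2.1
  rw [tsum_eq_zero_of_not_summable hs] at this
  norm_num at this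

lemma bbTrans_le_one {M : ℕ} {q : ℕ → ℝ} (hq : ∀ j, q j ∈ Set.Ioo (0 : ℝ) 1)
    (hM : ∀ j, M ≤ j → q j = 1 / 2) (l m : ℕ) : bbTrans q l m ≤ 1 :=
  le_hasSum (hasSum_failLaw hM (l + 1)) m fun j _ => (bbTrans_pos hq l j).le

lemma summable_stationary_mul {M : ℕ} {q π : ℕ → ℝ} (hq : ∀ j, q j ∈ Set.Ioo (0 : ℝ) 1)
    (hM : ∀ j, M ≤ j → q j = 1 / 2) (h : IsStationaryDist q π) (m : ℕ) :
    Summable fun l => π l * bbTrans q l m :=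
  h.summable.of_nonneg_of_le (fun l => mul_nonneg (h.1 l) (bbTrans_pos hq l m).le)
    fun l => mul_le_of_le_one_right (h.1 l) (bbTrans_le_one hq hM l m)

lemma IsStationaryDist.pos {M : ℕ} {q π : ℕ → ℝ} (hq : ∀ j, q j ∈ Set.Ioo (0 : ℝ) 1)
    (hM : ∀ j, M ≤ j → q j = 1 / 2) (h : IsStationaryDist q π) (m : ℕ) : 0 < π m := by
  obtain ⟨l, hl⟩ : ∃ l, 0 < π l := by
    by_contra! hn
    have h0 : π = fun _ => 0 := funext fun l => le_antisymm (hn l) (h.1 l)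
    have := h.2.1
    simp [h0] at this
  rw [h.2.2 m]
  exact (summable_stationary_mul hq hM h m).tsum_pos
    (fun l => mul_nonneg (h.1 l) (bbTrans_pos hq l m).le) l (mul_pos hl (bbTrans_pos hq l m))

lemma IsStationaryDist.hasSum_sub_eq_zero {M : ℕ} {q π : ℕ → ℝ}
    (hq : ∀ j, q j ∈ Set.Ioo (0 : ℝ) 1)
    (hM : ∀ j, M ≤ j → q j = 1 / 2) (h : IsStationaryDist q π) {f : ℕ → ℝ} {R : ℝ}
    (hf : ∀ m, 0 ≤ f m) (hfR : ∀ m, f m ≤ R) :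
    HasSum (fun l => π l * ((∑' m, f m * bbTrans q l m) - f l)) 0 := by
  have hb : ∀ l, HasSum (bbTrans q l) 1 := fun l => hasSum_failLaw hM (l + 1)
  have hs : ∀ l, Summable fun m => f m * bbTrans q l m := fun l =>
    ((hb l).summable.mul_left R).of_nonneg_of_le
      (fun m => mul_nonneg (hf m) (bbTrans_pos hq l m).le)
      fun m => mul_le_mul_of_nonneg_right (hfR m) (bbTrans_pos hq l m).le
  have hle : ∀ l, ∑' m, f m * bbTrans q l m ≤ R := fun l => by
    have := hasSum_le (fun m => mul_le_mul_of_nonneg_right (hfR m) (bbTrans_pos hq l m).le)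
      (hs l).hasSum ((hb l).mul_left R)
    simpa using this
  have h0 : ∀ l, 0 ≤ ∑' m, f m * bbTrans q l m := fun l =>
    tsum_nonneg fun m => mul_nonneg (hf m) (bbTrans_pos hq l m).le
  have hs1 : Summable fun l => π l * ∑' m, f m * bbTrans q l m :=
    (h.summable.mul_right R).of_nonneg_of_le (fun l => mul_nonneg (h.1 l) (h0 l))
      fun l => mul_le_mul_of_nonneg_left (hle l) (h.1 l)
  have hs2 : Summable fun l => π l * f l :=
    (h.summable.mul_right R).of_nonneg_of_le (fun l => mul_nonneg (h.1 l) (hf l))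
      fun l => mul_le_mul_of_nonneg_left (hfR l) (h.1 l)
  have hp : Summable fun x : ℕ × ℕ => π x.1 * (f x.2 * bbTrans q x.1 x.2) := by
    refine (summable_prod_of_nonneg fun x => ?_).2 ⟨fun l => (hs l).mul_left (π l), ?_⟩
    · exact mul_nonneg (h.1 x.1) (mul_nonneg (hf x.2) (bbTrans_pos hq x.1 x.2).le)
    · simpa only [tsum_mul_left] using hs1
  have hcomm : ∑' l, π l * ∑' m, f m * bbTrans q l m = ∑' m, π m * f m := by
    simp only [← tsum_mul_left]
    rw [← Summable.tsum_comm (f := fun l m => π l * (f m * bbTrans q l m)) hp]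
    refine tsum_congr fun m => ?_
    rw [h.2.2 m, ← tsum_mul_right]
    exact tsum_congr fun l => by ring
  have := hs1.hasSum.sub hs2.hasSum
  rw [hcomm, sub_self] at this
  simpa only [mul_sub] using this

/-- A bounded concave increasing function applied to the excess over the level `M`. -/
noncomputable def excessTest (M : ℕ) (R : ℝ) (m : ℕ) : ℝ :=
  max ((m : ℝ) - M) 0 * R / (max ((m : ℝ) - M) 0 + R)

lemma excessTest_nonneg (M : ℕ) {R : ℝ} (hR : 0 < R) (m : ℕ) : 0 ≤ excessTest M R m := by
  unfold excessTest
  positivity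

lemma excessTest_le (M : ℕ) {R : ℝ} (hR : 0 < R) (m : ℕ) : excessTest M R m ≤ R := by
  unfold excessTest
  have : 0 ≤ max ((m : ℝ) - M) 0 := le_max_right _ _
  rw [div_le_iff₀ (by positivity)]
  nlinarith

lemma concave_quotient_bound {R u y : ℝ} (hR : 0 < R) (hu : 0 ≤ u) (hy : 0 ≤ y) :
    (R / (u + R)) ^ 2 * (y - u) - R / (u + R) ^ 2 * (y - u) ^ 2
      ≤ y * R / (y + R) - u * R / (u + R) := by
  have h1 : y * R / (y + R) - u * R / (u + R)
      - ((R / (u + R)) ^ 2 * (y - u) - R / (u + R) ^ 2 * (y - u) ^ 2)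
      = R * y * (y - u) ^ 2 / ((u + R) ^ 2 * (y + R)) := by
    field_simp
    ring
  have : 0 ≤ R * y * (y - u) ^ 2 / ((u + R) ^ 2 * (y + R)) := by positivity
  linarith

lemma exists_drift_lower_bound {M : ℕ} {q : ℕ → ℝ} (hq : ∀ j, q j ∈ Set.Ioo (0 : ℝ) 1)
    (hM : ∀ j, M ≤ j → q j = 1 / 2) (hδ : ∑ j ∈ Finset.range M, (2 * q j - 1) ≤ 1) :
    ∃ C, 0 ≤ C ∧ ∀ R : ℝ, 1 ≤ R → 2 * M ≤ R → ∀ l : ℕ,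
      -(C * ((l + 1) / (l + R)))
        ≤ (∑' m, excessTest M R m * bbTrans q l m) - excessTest M R l := by
  obtain ⟨C, hC, h⟩ := exists_hasSum_sq_failLaw hq hM
  refine ⟨4 * (4 * C + 2), by positivity, fun R hR hMR l => ?_⟩
  obtain ⟨v, hv, hvC⟩ := h (l + 1)
  obtain ⟨e, he, heq⟩ := exists_hasSum_mul_failLaw hM (l + 1)
  have h1 := hasSum_failLaw hM (l + 1)
  have hR0 : 0 < R := by linarith
  have hs : HasSum (fun m => excessTest M R m * failLaw q (l + 1) m)
      (∑' m, excessTest M R m * bbTrans q l m) :=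
    (((h1.summable.mul_left R).of_nonneg_of_le
      (fun m => mul_nonneg (excessTest_nonneg M hR0 m) (failLaw_nonneg hq _ m))
      fun m => mul_le_mul_of_nonneg_right (excessTest_le M hR0 m)
        (failLaw_nonneg hq _ m))).hasSum
  set u : ℝ := max ((l : ℝ) - M) 0 with hu
  have hu0 : 0 ≤ u := le_max_right _ _
  set β : ℝ := R / (u + R) ^ 2 with hβ
  have hβ0 : 0 ≤ β := by positivity
  obtain ⟨α, hα, hαe, hαm⟩ : ∃ α : ℝ, 0 ≤ α ∧ 0 ≤ α * (e - l) ∧ ∀ m : ℕ,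
      α * ((m : ℝ) - l) ≤ (R / (u + R)) ^ 2 * (max ((m : ℝ) - M) 0 - u) := by
    rcases le_or_gt M l with hl | hl
    · have hl' : (M : ℝ) ≤ l := by exact_mod_cast hl
      refine ⟨(R / (u + R)) ^ 2, by positivity, mul_nonneg (by positivity) ?_, fun m => ?_⟩
      · rw [heq (by omega)]; push_cast; linarith
      · refine mul_le_mul_of_nonneg_left ?_ (by positivity)
        rw [hu, max_eq_left (by linarith : (0 : ℝ) ≤ l - M)]
        linarith [le_max_left ((m : ℝ) - M) 0]
    · refine ⟨0, le_rfl, by simp, fun m => ?_⟩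
      have hl' : (l : ℝ) ≤ M := by exact_mod_cast hl.le
      have : u = 0 := max_eq_right (by linarith)
      rw [this]
      have := le_max_right ((m : ℝ) - M) 0
      simp only [zero_mul, sub_zero]
      positivity
  have key : ∀ m : ℕ, (α * ((m : ℝ) - l) - β * (2 * ((m : ℝ) - (l + 1 : ℕ)) ^ 2 + 2))
      * failLaw q (l + 1) m ≤ (excessTest M R m - excessTest M R l) * failLaw q (l + 1) m := by
    intro m
    refine mul_le_mul_of_nonneg_right ?_ (failLaw_nonneg hq _ m)
    have hb := concave_quotient_bound hR0 hu0 (le_max_right ((m : ℝ) - M) 0)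
    have hsq : (max ((m : ℝ) - M) 0 - u) ^ 2 ≤ 2 * ((m : ℝ) - (l + 1 : ℕ)) ^ 2 + 2 := by
      have h2 : |max ((m : ℝ) - M) 0 - u| ≤ |(m : ℝ) - l| := by
        have := abs_max_sub_max_le_abs ((m : ℝ) - M) ((l : ℝ) - M) 0
        simpa [hu] using this
      have h3 := sq_le_sq.2 h2
      push_cast
      nlinarith [sq_nonneg ((m : ℝ) - l - 2)]
    have := mul_le_mul_of_nonneg_left hsq hβ0
    have := hαm m
    unfold excessTest
    linarith
  have hL : HasSum (fun m : ℕ => (α * ((m : ℝ) - l) - β * (2 * ((m : ℝ) - (l + 1 : ℕ)) ^ 2 + 2))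
      * failLaw q (l + 1) m) (α * (e - l * 1) - β * (2 * v + 2 * 1)) := by
    convert! ((he.sub (h1.mul_left (l : ℝ))).mul_left α).sub
      (((hv.mul_left 2).add (h1.mul_left 2)).mul_left β) using 1
    ext m; ring
  have hRr : HasSum (fun m => (excessTest M R m - excessTest M R l) * failLaw q (l + 1) m)
      ((∑' m, excessTest M R m * bbTrans q l m) - excessTest M R l * 1) := by
    convert! hs.sub (h1.mul_left (excessTest M R l)) using 1
    ext m; ring
  have hfin := hasSum_le key hL hRr
  have hβle : β ≤ 4 / (l + R) := by
    have hul : (l + R) / 2 ≤ u + R := by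
      have : (l : ℝ) - M ≤ u := le_max_left _ _
      linarith
    have hlR : 0 < (l : ℝ) + R := by positivity
    rw [hβ, div_le_div_iff₀ (by positivity) hlR]
    have : ((l + R) / 2) ^ 2 ≤ (u + R) ^ 2 := by gcongr
    have h3 : R * (l + R) ≤ (l + R) ^ 2 := by nlinarith [(l.cast_nonneg : (0 : ℝ) ≤ l)]
    linarith
  have hv2 : 2 * v + 2 * 1 ≤ (4 * C + 2) * (l + 1) := by
    push_cast at hvC
    nlinarith [(l.cast_nonneg : (0 : ℝ) ≤ l), mul_nonneg hC (l.cast_nonneg : (0 : ℝ) ≤ l)]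
  have h5 : β * (2 * v + 2 * 1) ≤ 4 / (l + R) * ((4 * C + 2) * (l + 1)) :=
    (mul_le_mul_of_nonneg_left hv2 hβ0).trans
      (mul_le_mul_of_nonneg_right hβle (by positivity))
  have h6 : 4 / (l + R) * ((4 * C + 2) * (l + 1)) = 4 * (4 * C + 2) * ((l + 1) / (l + R)) := by
    ring
  linarith

theorem IsStationaryDist.one_lt_drift {M : ℕ} {q π : ℕ → ℝ}
    (hq : ∀ j, q j ∈ Set.Ioo (0 : ℝ) 1) (hM : ∀ j, M ≤ j → q j = 1 / 2)
    (h : IsStationaryDist q π) : 1 < ∑ j ∈ Finset.range M, (2 * q j - 1) := by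
  by_contra! hδ
  obtain ⟨C, hC, hdrift⟩ := exists_drift_lower_bound hq hM hδ
  have hlim : Tendsto (fun n : ℕ => ∑' l : ℕ, π l * (C * (((l : ℝ) + 1) / (l + n)))) atTop
      (𝓝 (∑' _ : ℕ, (0 : ℝ))) := by
    refine tendsto_tsum_of_dominated_convergence (bound := fun l => π l * C) 
      (h.summable.mul_right C) (fun l => ?_) ?_
    · have h1 : Tendsto (fun n : ℕ => (l : ℝ) + n) atTop atTop :=
        tendsto_atTop_add_const_left _ _ tendsto_natCast_atTop_atTop
      simpa using ((h1.const_div_atTop ((l : ℝ) + 1)).const_mul C).const_mul (π l)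
    · filter_upwards [eventually_ge_atTop 1] with n hn l
      have hn' : (1 : ℝ) ≤ n := by exact_mod_cast hn
      have h0 : ((l : ℝ) + 1) / (l + n) ≤ 1 := by
        rw [div_le_one (by positivity)]; linarith
      rw [Real.norm_of_nonneg (mul_nonneg (h.1 l) (by positivity))]
      exact mul_le_mul_of_nonneg_left (mul_le_of_le_one_right hC h0) (h.1 l)
  rw [tsum_zero] at hlim
  have hpos : 0 < π 0 * (bbTrans q 0 (M + 1) * (1 / 2)) :=
    mul_pos (h.pos hq hM 0) (mul_pos (bbTrans_pos hq _ _) (by norm_num))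
  obtain ⟨n, hn, hn1⟩ := ((hlim.eventually_lt_const hpos).and
    (eventually_ge_atTop (2 * M + 1))).exists
  have hn1' : (2 * M + 1 : ℝ) ≤ n := by exact_mod_cast hn1
  have hM0 : (0 : ℝ) ≤ M := M.cast_nonneg
  have hR : (1 : ℝ) ≤ n := by linarith
  have hn0 : (0 : ℝ) < n := by linarith
  have hz := h.hasSum_sub_eq_zero hq hM (excessTest_nonneg M hn0) (excessTest_le M hn0)
  have hsC : Summable fun l : ℕ => π l * (C * (((l : ℝ) + 1) / (l + n))) := by
    refine (h.summable.mul_right C).of_nonneg_of_le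
      (fun l => mul_nonneg (h.1 l) (by positivity)) fun l => ?_
    refine mul_le_mul_of_nonneg_left (mul_le_of_le_one_right hC ?_) (h.1 l)
    rw [div_le_one (by positivity)]; linarith
  have hsum := hz.add hsC.hasSum
  have h0 := le_hasSum hsum 0 fun l _ => by
    rw [← mul_add]
    exact mul_nonneg (h.1 l) (by linarith [hdrift n hR (by linarith) l])
  have hf0 : excessTest M n 0 = 0 := by simp [excessTest]
  have hfM : (1 : ℝ) / 2 ≤ excessTest M n (M + 1) := by
    have : max (((M + 1 : ℕ) : ℝ) - M) 0 = 1 := by push_cast; simp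
    rw [excessTest, this, div_le_div_iff₀ (by norm_num) (by positivity)]
    linarith
  have hs0 : Summable fun m => excessTest M n m * bbTrans q 0 m :=
    ((hasSum_failLaw hM 1).summable.mul_left (n : ℝ)).of_nonneg_of_le
      (fun m => mul_nonneg (excessTest_nonneg M hn0 m) (bbTrans_pos hq 0 m).le)
      fun m => mul_le_mul_of_nonneg_right (excessTest_le M hn0 m) (bbTrans_pos hq 0 m).le
  have h2 := hs0.le_tsum (M + 1) fun m _ =>
    mul_nonneg (excessTest_nonneg M hn0 m) (bbTrans_pos hq 0 m).le
  have h3 := mul_le_mul_of_nonneg_right hfM (bbTrans_pos hq 0 (M + 1)).le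
  have h4 : 0 ≤ π 0 * (C * ((((0 : ℕ) : ℝ) + 1) / (((0 : ℕ) : ℝ) + n))) :=
    mul_nonneg (h.1 0) (by positivity)
  have h5 : π 0 * (bbTrans q 0 (M + 1) * (1 / 2))
      ≤ π 0 * ((∑' m, excessTest M n m * bbTrans q 0 m) - excessTest M n 0) :=
    mul_le_mul_of_nonneg_left (by linarith) (h.1 0)
  linarith

lemma ENNReal.eq_of_le_of_tsum_eq {f g : ℕ → ℝ≥0∞} (h : ∀ i, f i ≤ g i)
    (hs : ∑' i, f i = ∑' i, g i) (hf : ∑' i, f i ≠ ∞) : f = g := by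
  funext i
  by_contra hi
  exact (ENNReal.tsum_lt_tsum hf h (lt_of_le_of_ne (h i) hi)).ne hs

section Kernel

variable {κ : ℕ → ℕ → ℝ≥0∞}

lemma tsum_stochastic (h1 : ∀ l, ∑' m, κ l m = 1) (ν : ℕ → ℝ≥0∞) :
    ∑' m, ∑' l, ν l * κ l m = ∑' l, ν l := by
  rw [ENNReal.tsum_comm]
  simp [ENNReal.tsum_mul_left, h1]

lemma ne_zero_of_invariant (hκ : ∀ l m, κ l m ≠ 0) {d : ℕ → ℝ≥0∞}
    (hd : ∀ m, ∑' l, d l * κ l m = d m) {l : ℕ} (hl : d l ≠ 0) (m : ℕ) : d m ≠ 0 := by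
  rw [← hd m]
  exact fun h => mul_ne_zero hl (hκ l m) (ENNReal.tsum_eq_zero.1 h l)

lemma invariant_of_subinvariant (h1 : ∀ l, ∑' m, κ l m = 1) {ν : ℕ → ℝ≥0∞}
    (hν : ∑' l, ν l ≠ ∞) (h : ∀ m, ∑' l, ν l * κ l m ≤ ν m) (m : ℕ) :
    ∑' l, ν l * κ l m = ν m :=
  congrFun (ENNReal.eq_of_le_of_tsum_eq h (tsum_stochastic h1 ν)
    (by rwa [tsum_stochastic h1])) m

/-- A stochastic matrix on `ℕ` with positive entries has at most one invariant law. -/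
lemma invariant_unique (h1 : ∀ l, ∑' m, κ l m = 1) (hκ : ∀ l m, κ l m ≠ 0)
    {ν π : ℕ → ℝ≥0∞} (hν1 : ∑' l, ν l = 1) (hπ1 : ∑' l, π l = 1)
    (hν : ∀ m, ∑' l, ν l * κ l m = ν m) (hπ : ∀ m, ∑' l, π l * κ l m = π m) : ν = π := by
  set θ : ℕ → ℝ≥0∞ := fun l => min (ν l) (π l) with hθ
  have hθ1 : ∑' l, θ l ≤ 1 := hν1 ▸ ENNReal.tsum_le_tsum fun l => min_le_left _ _
  have hθf : ∑' l, θ l ≠ ∞ := (hθ1.trans_lt ENNReal.one_lt_top).ne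
  have hθi := invariant_of_subinvariant h1 hθf fun m => le_min
    (hν m ▸ ENNReal.tsum_le_tsum fun l => mul_le_mul_left (min_le_left _ _) _)
    (hπ m ▸ ENNReal.tsum_le_tsum fun l => mul_le_mul_left (min_le_right _ _) _)
  have key : ∀ σ : ℕ → ℝ≥0∞, (∀ l, θ l ≤ σ l) → (∀ m, ∑' l, σ l * κ l m = σ m) →
      ∀ m, ∑' l, (σ l - θ l) * κ l m = σ m - θ m := by
    intro σ hσ hσi m
    have hθm : θ m ≠ ∞ := ENNReal.ne_top_of_tsum_ne_top hθf m
    have : ∑' l, (σ l - θ l) * κ l m + θ m = σ m - θ m + θ m := by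
      rw [tsub_add_cancel_of_le (hσ m), ← hθi m, ← ENNReal.tsum_add, ← hσi m]
      exact tsum_congr fun l => by rw [← add_mul, tsub_add_cancel_of_le (hσ l)]
    exact (ENNReal.add_left_inj hθm).1 this
  have final : ∀ σ τ : ℕ → ℝ≥0∞, (∀ l, θ l ≤ σ l) → (∀ l, θ l ≤ τ l) → ∑' l, σ l = 1 →
      ∑' l, τ l = 1 → (∀ m, ∑' l, σ l * κ l m = σ m) → θ 0 = σ 0 → θ = τ := by
    intro σ τ hσ hτ hσ1 hτ1 hσi h0
    have hz : ∀ l, σ l - θ l = 0 := by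
      by_contra! hl
      obtain ⟨l, hl⟩ := hl
      exact ne_zero_of_invariant hκ (key σ hσ hσi) hl 0 (by rw [h0, tsub_self])
    have hθσ : θ = σ := funext fun l => le_antisymm (hσ l) (tsub_eq_zero_iff_le.1 (hz l))
    exact ENNReal.eq_of_le_of_tsum_eq hτ (by rw [hθσ, hσ1, hτ1]) hθf
  have final2 : ∀ σ : ℕ → ℝ≥0∞, (∀ l, θ l ≤ σ l) → ∑' l, σ l = 1 →
      (∀ m, ∑' l, σ l * κ l m = σ m) → θ 0 = σ 0 → ν = π := fun σ h h' h'' h0 =>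
    (final σ ν h (fun l => min_le_left _ _) h' hν1 h'' h0).symm.trans
      (final σ π h (fun l => min_le_right _ _) h' hπ1 h'' h0)
  rcases min_choice (ν 0) (π 0) with h0 | h0
  · exact final2 ν (fun l => min_le_left _ _) hν1 hν h0
  · exact final2 π (fun l => min_le_right _ _) hπ1 hπ h0

/-- The law at time `n` of the chain started at `0`. -/
noncomputable def lawFromZero (κ : ℕ → ℕ → ℝ≥0∞) : ℕ → ℕ → ℝ≥0∞
  | 0, m => if m = 0 then 1 else 0
  | n + 1, m => ∑' l, lawFromZero κ n l * κ l m

lemma tsum_lawFromZero (h1 : ∀ l, ∑' m, κ l m = 1) (n : ℕ) : ∑' m, lawFromZero κ n m = 1 := by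
  induction n with
  | zero => simp [lawFromZero]
  | succ n ih => simp only [lawFromZero]; rw [tsum_stochastic h1, ih]

lemma lawFromZero_mul_le {π : ℕ → ℝ≥0∞} (hπ : ∀ m, ∑' l, π l * κ l m = π m) (n m : ℕ) :
    lawFromZero κ n m * π 0 ≤ π m := by
  induction n generalizing m with
  | zero => simp only [lawFromZero]; split_ifs with h <;> simp [h]
  | succ n ih =>
    rw [← hπ m, lawFromZero, ← ENNReal.tsum_mul_right]
    refine ENNReal.tsum_le_tsum fun l => ?_
    rw [mul_right_comm]
    exact mul_le_mul_left (ih l) _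

lemma invariant_of_tendsto (h1 : ∀ l, ∑' m, κ l m = 1) {ν : ℕ → ℝ≥0∞}
    (hlim : ∀ m, Tendsto (fun n => lawFromZero κ n m) atTop (𝓝 (ν m))) :
    ∑' l, ν l ≤ 1 ∧ ∀ m, ∑' l, ν l * κ l m = ν m := by
  have hle : ∑' l, ν l ≤ 1 := by
    refine ENNReal.summable.tsum_le_of_sum_le fun s => ?_
    refine le_of_tendsto' (tendsto_finsetSum s fun i _ => hlim i) fun n => ?_
    rw [← tsum_lawFromZero h1 n]
    exact ENNReal.sum_le_tsum s
  refine ⟨hle, invariant_of_subinvariant h1 (hle.trans_lt ENNReal.one_lt_top).ne fun m => ?_⟩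
  refine ENNReal.summable.tsum_le_of_sum_le fun s => ?_
  have hκ : ∀ l m, κ l m ≠ ∞ := fun l m =>
    ENNReal.ne_top_of_tsum_ne_top (by rw [h1 l]; exact ENNReal.one_ne_top) m
  refine le_of_tendsto_of_tendsto' (tendsto_finsetSum s fun i _ =>
    ENNReal.Tendsto.mul_const (hlim i) (Or.inr (hκ i m)))
    ((tendsto_add_atTop_iff_nat 1).2 (hlim m)) fun n => ?_
  rw [lawFromZero]
  exact ENNReal.sum_le_tsum s

lemma tendsto_eq_invariant (h1 : ∀ l, ∑' m, κ l m = 1) (hκ : ∀ l m, κ l m ≠ 0)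
    {ν π : ℕ → ℝ≥0∞} (hπ1 : ∑' l, π l = 1) (hπ : ∀ m, ∑' l, π l * κ l m = π m)
    (hlim : ∀ m, Tendsto (fun n => lawFromZero κ n m) atTop (𝓝 (ν m))) : ν = π := by
  have hπ0 : π 0 ≠ 0 := by
    obtain ⟨l, hl⟩ : ∃ l, π l ≠ 0 := by
      by_contra! hn
      simp [hn] at hπ1
    exact ne_zero_of_invariant hκ hπ hl 0
  have hπt : π 0 ≠ ∞ := ENNReal.ne_top_of_tsum_ne_top (by rw [hπ1]; exact ENNReal.one_ne_top) 0
  refine invariant_unique h1 hκ ?_ hπ1 (invariant_of_tendsto h1 hlim).2 hπ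
  have hdom := tendsto_lintegral_of_dominated_convergence (μ := Measure.count)
    (F := fun n m => lawFromZero κ n m) (f := ν) (fun m => π m / π 0)
    (fun n => measurable_of_countable _)
    (fun n => ae_of_all _ fun m => by
      rw [ENNReal.le_div_iff_mul_le (Or.inl hπ0) (Or.inl hπt)]
      exact lawFromZero_mul_le hπ n m)
    (by
      rw [lintegral_count]
      simp only [div_eq_mul_inv]
      rw [ENNReal.tsum_mul_right, hπ1, one_mul]
      exact ENNReal.inv_ne_top.2 hπ0)
    (ae_of_all _ hlim)
  simp only [lintegral_count, tsum_lawFromZero h1] at hdom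
  exact (tendsto_nhds_unique hdom tendsto_const_nhds)

lemma exists_tendsto_lawFromZero (h1 : ∀ l, ∑' m, κ l m = 1)
    (hmono : ∀ j, Antitone fun n => ∑ i ∈ Finset.range j, lawFromZero κ n i) :
    ∃ ν : ℕ → ℝ≥0∞, ∀ m, Tendsto (fun n => lawFromZero κ n m) atTop (𝓝 (ν m)) := by
  have hS := fun j => tendsto_atTop_iInf (hmono j)
  have hfin : ∀ n j, ∑ i ∈ Finset.range j, lawFromZero κ n i ≠ ∞ := fun n j =>
    (((ENNReal.sum_le_tsum _).trans (tsum_lawFromZero h1 n).le).trans_lt ENNReal.one_lt_top).ne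
  refine ⟨fun m => (⨅ n, ∑ i ∈ Finset.range (m + 1), lawFromZero κ n i)
    - ⨅ n, ∑ i ∈ Finset.range m, lawFromZero κ n i, fun m => ?_⟩
  have := ENNReal.Tendsto.sub (hS (m + 1)) (hS m)
    (Or.inl (((iInf_le _ 0).trans_lt (hfin 0 (m + 1)).lt_top).ne))
  refine this.congr fun n => ?_
  rw [Finset.sum_range_succ]
  exact ENNReal.add_sub_cancel_left (hfin n m)

/-- Foster's criterion for a chain whose laws started from `0` are stochastically monotone. -/
lemma exists_invariant_of_drift (h1 : ∀ l, ∑' m, κ l m = 1)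
    (hmono : ∀ j, Antitone fun n => ∑ i ∈ Finset.range j, lawFromZero κ n i)
    {ε B : ℝ≥0∞} {M : ℕ} (hε : ε ≠ 0) (hεt : ε ≠ ∞) (hB : B ≠ ∞)
    (hdrift : ∀ l, (∑' m, κ l m * m) + ε ≤ l + if l < M then B else 0) :
    ∃ ν : ℕ → ℝ≥0∞, ∑' l, ν l = 1 ∧ ∀ m, ∑' l, ν l * κ l m = ν m := by
  obtain ⟨ν, hν⟩ := exists_tendsto_lawFromZero h1 hmono
  obtain ⟨hle, hinv⟩ := invariant_of_tendsto h1 hν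
  suffices hne : ∑' l, ν l ≠ 0 by
    have hfin : ∑' l, ν l ≠ ∞ := (hle.trans_lt ENNReal.one_lt_top).ne
    refine ⟨fun l => (∑' l, ν l)⁻¹ * ν l, ?_, fun m => ?_⟩
    · rw [ENNReal.tsum_mul_left, ENNReal.inv_mul_cancel hne hfin]
    · simp only [mul_assoc]
      rw [ENNReal.tsum_mul_left, hinv]
  intro h0
  have hν0 : ∀ l, ν l = 0 := ENNReal.tsum_eq_zero.1 h0
  set mean : ℕ → ℝ≥0∞ := fun n => ∑' l, lawFromZero κ n l * l with hmean
  have hstep : ∀ n, mean (n + 1) + ε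
      ≤ mean n + B * ∑ l ∈ Finset.range M, lawFromZero κ n l := by
    intro n
    have e1 : mean (n + 1) = ∑' l, lawFromZero κ n l * ∑' m, κ l m * m := by
      simp only [hmean, lawFromZero, ← ENNReal.tsum_mul_right, ← ENNReal.tsum_mul_left]
      rw [ENNReal.tsum_comm]
      simp only [mul_assoc]
    have e2 : ε = ∑' l, lawFromZero κ n l * ε := by
      rw [ENNReal.tsum_mul_right, tsum_lawFromZero h1, one_mul]
    have e3 : B * ∑ l ∈ Finset.range M, lawFromZero κ n l
        = ∑' l, lawFromZero κ n l * if l < M then B else 0 := by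
      rw [tsum_eq_sum (s := Finset.range M), Finset.mul_sum]
      · refine Finset.sum_congr rfl fun l hl => ?_
        rw [if_pos (Finset.mem_range.1 hl), mul_comm]
      · intro l hl
        rw [if_neg (by simpa using hl), mul_zero]
    rw [e1, e3]
    nth_rewrite 1 [e2]
    rw [← ENNReal.tsum_add, hmean, ← ENNReal.tsum_add]
    refine ENNReal.tsum_le_tsum fun l => ?_
    rw [← mul_add, ← mul_add]
    exact mul_le_mul_right (hdrift l) _
  have hmf : ∀ n, mean n ≠ ∞ := by
    intro n
    induction n with
    | zero =>
      have : mean 0 = 0 := by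
        simp only [hmean, lawFromZero, ENNReal.tsum_eq_zero]
        intro l
        split_ifs with h <;> simp [h]
      rw [this]
      exact ENNReal.zero_ne_top
    | succ n ih =>
      refine ((le_self_add.trans (hstep n)).trans_lt (ENNReal.add_lt_top.2 ⟨ih.lt_top, ?_⟩)).ne
      refine ENNReal.mul_lt_top hB.lt_top ?_
      exact ((ENNReal.sum_le_tsum _).trans (tsum_lawFromZero h1 n).le).trans_lt ENNReal.one_lt_top
  have hε2 : 0 < ε / 2 := ENNReal.half_pos hε
  have hlim : Tendsto (fun n => B * ∑ l ∈ Finset.range M, lawFromZero κ n l) atTop (𝓝 0) := by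
    have := ENNReal.Tendsto.const_mul (tendsto_finsetSum (Finset.range M) fun i _ => hν i)
      (a := B) (Or.inr hB)
    simpa [hν0] using this
  obtain ⟨N, hN⟩ := eventually_atTop.1 (hlim.eventually_le_const hε2)
  have hdec : ∀ k, mean (N + k) + k * (ε / 2) ≤ mean N := by
    intro k
    induction k with
    | zero => simp
    | succ k ih =>
      have h2 : mean (N + k + 1) + ε / 2 + ε / 2 ≤ mean (N + k) + ε / 2 := by
        rw [add_assoc, ENNReal.add_halves]
        exact (hstep _).trans (add_le_add_right (hN _ (by omega)) _)
      have h3 := (ENNReal.add_le_add_iff_right (ENNReal.div_ne_top hεt two_ne_zero)).1 h2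
      calc mean (N + (k + 1)) + ((k + 1 : ℕ) : ℝ≥0∞) * (ε / 2)
          = mean (N + k + 1) + ε / 2 + k * (ε / 2) := by push_cast; rw [add_assoc]; ring_nf
        _ ≤ mean (N + k) + k * (ε / 2) := add_le_add_left h3 _
        _ ≤ mean N := ih
  obtain ⟨k, hk⟩ := ENNReal.exists_nat_mul_gt hε2.ne' (hmf N)
  exact absurd (le_add_self.trans (hdec k)) (not_le.2 hk)

end Kernel

/-- The law of a coin showing `true` with probability `t`. -/
noncomputable def coin (t : ℝ) : Measure Bool :=
  min (ENNReal.ofReal t) 1 • Measure.dirac true + (1 - min (ENNReal.ofReal t) 1) • Measure.dirac false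

instance (t : ℝ) : IsProbabilityMeasure (coin t) := by
  constructor
  simp [coin, add_tsub_cancel_of_le]

lemma coin_singleton {t : ℝ} (ht : t ∈ Set.Ioo (0 : ℝ) 1) (b : Bool) :
    coin t {b} = ENNReal.ofReal (if b then t else 1 - t) := by
  have h1 : ENNReal.ofReal t ≤ 1 := by
    simpa using ENNReal.ofReal_le_ofReal ht.2.le
  cases b
  · simp [coin, h1, ENNReal.ofReal_sub 1 ht.1.le]
  · simp [coin, h1]

/-- Configurations of arrows: `ω (x, i)` says whether the `i+1`-st departure from the site `x`
is to the right. -/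
abbrev Arrows : Type := ℤ × ℕ → Bool

/-- Independent arrows, where the `i+1`-st arrow at each site has bias `q i`. -/
noncomputable def arrowMeasure (q : ℕ → ℝ) : Measure Arrows :=
  Measure.infinitePi fun a => coin (q a.2)

instance (q : ℕ → ℝ) : IsProbabilityMeasure (arrowMeasure q) := by
  unfold arrowMeasure; infer_instance

/-- The σ-algebra generated by the arrows with index in `S`. -/
@[reducible] def arrowSigma (S : Set (ℤ × ℕ)) : MeasurableSpace Arrows :=
  ⨆ i ∈ S, MeasurableSpace.comap (fun ω : Arrows => ω i) inferInstance

lemma measurable_arrowSigma {α : Type*} [MeasurableSpace α] {f : Arrows → α} (hf : Measurable f)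
    {S : Set (ℤ × ℕ)} (hS : DependsOn f S) : Measurable[arrowSigma S] f := by
  classical
  have hmask : Measurable[arrowSigma S] fun (ω : Arrows) i => if i ∈ S then ω i else false := by
    refine @measurable_pi_lambda _ _ _ (arrowSigma S) _ _ fun i => ?_
    by_cases hi : i ∈ S
    · simp only [hi, if_true]
      exact Measurable.mono (comap_measurable _) (le_iSup₂ (f := fun i (_ : i ∈ S) =>
        MeasurableSpace.comap (fun ω : Arrows => ω i) inferInstance) i hi) le_rfl
    · simp only [hi, if_false]
      exact measurable_const
  have : f = f ∘ fun (ω : Arrows) i => if i ∈ S then ω i else false := by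
    funext ω
    exact hS fun i hi => by simp [hi]
  rw [this]
  exact hf.comp hmask

lemma comap_eval_le (i : ℤ × ℕ) :
    MeasurableSpace.comap (fun ω : Arrows => ω i) inferInstance ≤ MeasurableSpace.pi :=
  (measurable_pi_apply i).comap_le

lemma iIndep_arrows (q : ℕ → ℝ) :
    iIndep (fun i => MeasurableSpace.comap (fun ω : Arrows => ω i) inferInstance)
      (arrowMeasure q) :=
  iIndepFun_infinitePi (P := fun a : ℤ × ℕ => coin (q a.2)) (X := fun _ b => b)
    fun _ => measurable_id

lemma indepFun_of_dependsOn (q : ℕ → ℝ) {α β : Type*} [MeasurableSpace α] [MeasurableSpace β]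
    {f : Arrows → α} {g : Arrows → β} (hf : Measurable f) (hg : Measurable g)
    {S T : Set (ℤ × ℕ)} (hS : DependsOn f S) (hT : DependsOn g T) (hST : Disjoint S T) :
    IndepFun f g (arrowMeasure q) := by
  have h := indep_iSup_of_disjoint (fun i => comap_eval_le i) (iIndep_arrows q) hST
  exact indep_of_indep_of_le_left (indep_of_indep_of_le_right h
    (measurable_arrowSigma hg hT).comap_le) (measurable_arrowSigma hf hS).comap_le

lemma zero_or_one_of_dependsOn (q : ℕ → ℝ) {A : Set Arrows} (hA : MeasurableSet A)
    (hd : ∀ k : ℤ, DependsOn (· ∈ A) {a : ℤ × ℕ | k ≤ a.1}) :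
    arrowMeasure q A = 0 ∨ arrowMeasure q A = 1 := by
  have hb : (comap Prod.fst atTop : Filter (ℤ × ℕ)).HasBasis (fun _ : ℤ => True)
      fun k => {a | k ≤ a.1} := atTop_basis.comap _
  refine measure_zero_or_one_of_measurableSet_limsup
    (f := comap Prod.fst atTop) (p := fun t : Set (ℤ × ℕ) => ∃ k : ℤ, t ⊆ {a | a.1 < k})
    (ns := fun k : ℤ => {a : ℤ × ℕ | a.1 < k})
    (fun i => comap_eval_le i) (iIndep_arrows q) ?_ ?_ ?_ ?_ ?_
  · rintro t ⟨k, hk⟩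
    refine hb.mem_iff.2 ⟨k, trivial, fun a ha hat => ?_⟩
    have h1 : a.1 < k := hk hat
    have h2 : k ≤ a.1 := ha
    omega
  · exact directed_of_isDirected_le fun k l hkl a (ha : a.1 < k) => lt_of_lt_of_le ha hkl
  · exact fun k => ⟨k, subset_rfl⟩
  · exact fun a => ⟨a.1 + 1, by simp⟩
  · rw [hb.limsup_eq_iInf_iSup]
    simp only [MeasurableSpace.measurableSet_iInf]
    intro k _
    have h := measurable_arrowSigma (f := (· ∈ A)) (measurable_mem.2 hA) (hd k)
    exact (@measurable_mem _ A (arrowSigma _)).1 h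

/-- The shift of a configuration by one site. -/
def shiftArrows (ω : Arrows) : Arrows := fun a => ω (a.1 + 1, a.2)

lemma measurePreserving_shiftArrows (q : ℕ → ℝ) :
    MeasurePreserving shiftArrows (arrowMeasure q) (arrowMeasure q) := by
  refine ⟨measurable_pi_lambda _ fun a => measurable_pi_apply _, ?_⟩
  have hinj : Function.Injective fun a : ℤ × ℕ => (a.1 + 1, a.2) := by
    rintro ⟨x, i⟩ ⟨y, j⟩ h
    simpa using h
  exact Measure.map_infinitePi_infinitePi_of_inj (P := fun a : ℤ × ℕ => coin (q a.2)) hinj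

lemma arrowMeasure_inter (q : ℕ → ℝ) {A B : Set Arrows} (hA : MeasurableSet A)
    (hB : MeasurableSet B) {S T : Set (ℤ × ℕ)} (hS : DependsOn (· ∈ A) S)
    (hT : DependsOn (· ∈ B) T) (hST : Disjoint S T) :
    arrowMeasure q (A ∩ B) = arrowMeasure q A * arrowMeasure q B := by
  have h := (indepFun_of_dependsOn q (measurable_mem.2 hA) (measurable_mem.2 hB) hS hT
    hST).measure_inter_preimage_eq_mul {True} {True} trivial trivial
  have hp : ∀ C : Set Arrows, (· ∈ C) ⁻¹' {True} = C := fun C => by ext; simp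
  simpa only [hp] using h

lemma arrowMeasure_arrow {q : ℕ → ℝ} (hq : ∀ j, q j ∈ Set.Ioo (0 : ℝ) 1) (a : ℤ × ℕ) (b : Bool) :
    arrowMeasure q {ω | ω a = b} = ENNReal.ofReal (if b then q a.2 else 1 - q a.2) := by
  rw [← coin_singleton (hq a.2)]
  exact (measurePreserving_eval_infinitePi (fun a : ℤ × ℕ => coin (q a.2)) a).measure_preimage
    (measurableSet_singleton b).nullMeasurableSet

lemma measurableSet_arrow (a : ℤ × ℕ) (b : Bool) : MeasurableSet {ω : Arrows | ω a = b} :=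
  (measurable_pi_apply (X := fun _ => Bool) a) (measurableSet_singleton b)

lemma succWeight_nonneg {q : ℕ → ℝ} (hq : ∀ j, q j ∈ Set.Ioo (0 : ℝ) 1) (N l : ℕ) :
    0 ≤ succWeight q N l := by
  refine Finset.sum_nonneg fun s _ => Finset.prod_nonneg fun j _ => ?_
  split_ifs
  · exact (hq _).1.le
  · linarith [(hq j).2]

/-- The number of `true` among the first `n` entries of `s`. -/
def trues (s : ℕ → Bool) (n : ℕ) : ℕ := Nat.count (fun i => s i = true) n

lemma trues_zero (s : ℕ → Bool) : trues s 0 = 0 := Nat.count_zero _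

lemma trues_succ (s : ℕ → Bool) (n : ℕ) :
    trues s (n + 1) = trues s n + if s n then 1 else 0 := Nat.count_succ _ n

lemma trues_succ' (s : ℕ → Bool) (n : ℕ) :
    trues s (n + 1) = trues (fun i => s (i + 1)) n + if s 0 then 1 else 0 :=
  Nat.count_succ' _ n

lemma trues_le (s : ℕ → Bool) (n : ℕ) : trues s n ≤ n := Nat.count_le _

lemma trues_congr {s t : ℕ → Bool} {n : ℕ} (h : ∀ i < n, s i = t i) : trues s n = trues t n := by
  induction n with
  | zero => simp [trues_zero]
  | succ n ih => rw [trues_succ, trues_succ, ih fun i hi => h i (by omega), h n (by omega)]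

lemma measurable_trues (n : ℕ) : Measurable fun s : ℕ → Bool => trues s n := by
  induction n with
  | zero => simp [trues_zero]
  | succ n ih =>
    simp only [trues_succ]
    refine ih.add (Measurable.ite ?_ measurable_const measurable_const)
    exact (measurable_pi_apply (X := fun _ => Bool) n) (measurableSet_singleton true)

lemma measurable_column (x : ℤ) (d : ℕ) :
    Measurable fun (ω : Arrows) i => ω (x, i + d) :=
  measurable_pi_lambda _ fun _ => measurable_pi_apply _

lemma arrowMeasure_trues {q : ℕ → ℝ} (hq : ∀ j, q j ∈ Set.Ioo (0 : ℝ) 1) (x : ℤ) (N l d : ℕ) :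
    arrowMeasure q {ω | trues (fun i => ω (x, i + d)) N = l} =
      ENNReal.ofReal (succWeight (fun j => q (j + d)) N l) := by
  induction N generalizing d l with
  | zero =>
    cases l <;> simp [trues_zero, succWeight_zero_left]
  | succ N ih =>
    have hmeas : ∀ l, MeasurableSet {ω : Arrows | trues (fun i => ω (x, i + (d + 1))) N = l} :=
      fun l => (measurable_trues N).comp (measurable_column x (d + 1)) (measurableSet_singleton l)
    have hdep : ∀ l, DependsOn (· ∈ {ω : Arrows | trues (fun i => ω (x, i + (d + 1))) N = l})
        {a : ℤ × ℕ | d < a.2} := by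
      intro l ω ω' h
      have : trues (fun i => ω (x, i + (d + 1))) N = trues (fun i => ω' (x, i + (d + 1))) N :=
        trues_congr fun i _ => h (x, i + (d + 1)) (show d < i + (d + 1) by omega)
      simp only [Set.mem_ofPred_eq, this]
    have hdep' : ∀ b, DependsOn (· ∈ {ω : Arrows | ω (x, d) = b}) {(x, d)} := by
      intro b ω ω' h
      simp only [Set.mem_ofPred_eq, h (x, d) rfl]
    have hdisj : Disjoint ({(x, d)} : Set (ℤ × ℕ)) {a : ℤ × ℕ | d < a.2} := by
      rw [Set.disjoint_singleton_left]
      exact lt_irrefl d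
    have hset : {ω : Arrows | trues (fun i => ω (x, i + d)) (N + 1) = l} =
        (if l = 0 then ∅ else {ω | ω (x, d) = true} ∩
            {ω | trues (fun i => ω (x, i + (d + 1))) N = l - 1}) ∪
          {ω | ω (x, d) = false} ∩ {ω | trues (fun i => ω (x, i + (d + 1))) N = l} := by
      ext ω
      simp only [Set.mem_ofPred_eq, trues_succ', Set.mem_union, Set.mem_inter_iff]
      have : (fun i => ω (x, i + 1 + d)) = fun i => ω (x, i + (d + 1)) := by
        funext i; congr 2; ring
      simp only [this, zero_add]
      cases hω : ω (x, d) <;> by_cases hl : l = 0 <;> simp [hl, hω]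
      omega
    rw [hset, measure_union, arrowMeasure_inter q (measurableSet_arrow _ _) (hmeas l) (hdep' _)
      (hdep l) hdisj, ih, arrowMeasure_arrow hq, succWeight_succ]
    · have e1 : (fun j => q (j + 1 + d)) = fun j => q (j + (d + 1)) := by
        funext j; congr 1; ring
      have h0 := hq d
      have hs := succWeight_nonneg (q := fun j => q (j + (d + 1))) (fun j => hq _) N
      by_cases hl : l = 0
      · simp only [hl, if_true, measure_empty, zero_add, e1, Bool.false_eq_true, if_false]
        rw [ENNReal.ofReal_mul (by linarith [h0.2])]
      · simp only [hl, if_false, zero_add, e1, Bool.false_eq_true]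
        rw [arrowMeasure_inter q (measurableSet_arrow _ _) (hmeas _) (hdep' _) (hdep _) hdisj, ih,
          arrowMeasure_arrow hq, if_pos rfl, ENNReal.ofReal_add, ENNReal.ofReal_mul h0.1.le,
          ENNReal.ofReal_mul (by linarith [h0.2])]
        · exact mul_nonneg h0.1.le (hs _)
        · exact mul_nonneg (by linarith [h0.2]) (hs _)
    · by_cases hl : l = 0
      · simp [hl]
      · simp only [hl, if_false]
        rw [Set.disjoint_left]
        rintro ω ⟨h1, _⟩ ⟨h2, _⟩
        simp_all
    · exact (measurableSet_arrow _ _).inter (hmeas l)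

/-- The number of `false` entries of `s` before the `r`-th `true` entry. -/
noncomputable def failureCount (s : ℕ → Bool) : ℕ → ℕ
  | 0 => 0
  | l + 1 => Nat.nth (fun i => s i = true) l - l

lemma failureCount_eq {s : ℕ → Bool} {l m : ℕ} (h1 : s (m + l) = true) (h2 : trues s (m + l) = l) :
    failureCount s (l + 1) = m := by
  have := Nat.nth_count (p := fun i => s i = true) h1
  rw [← trues, h2] at this
  rw [failureCount, this, Nat.add_sub_cancel]

lemma failureCount_eq_zero {s : ℕ → Bool} {l : ℕ}
    (h : ¬ ∃ m, s (m + l) = true ∧ trues s (m + l) = l) : failureCount s (l + 1) = 0 := by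
  by_contra h0
  have hn : Nat.nth (fun i => s i = true) l ≠ 0 := by
    intro hn; simp [failureCount, hn] at h0
  have hc := fun hf => Nat.lt_card_toFinset_of_nth_ne_zero hn hf
  have hle := Nat.le_nth hc
  refine h ⟨Nat.nth (fun i => s i = true) l - l, ?_, ?_⟩
  · rw [Nat.sub_add_cancel hle]; exact Nat.nth_mem_of_ne_zero hn
  · rw [Nat.sub_add_cancel hle]; exact Nat.count_nth hc

lemma measurable_failureCount (r : ℕ) : Measurable fun s : ℕ → Bool => failureCount s r := by
  cases r with
  | zero => exact measurable_const
  | succ l =>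
    have hE : ∀ m, MeasurableSet {s : ℕ → Bool | s (m + l) = true ∧ trues s (m + l) = l} :=
      fun m => MeasurableSet.inter
        ((measurable_pi_apply (X := fun _ => Bool) (m + l)) (measurableSet_singleton true))
        (measurable_trues (m + l) (measurableSet_singleton l))
    refine measurable_to_countable' fun m => ?_
    have : (fun s : ℕ → Bool => failureCount s (l + 1)) ⁻¹' {m} =
        {s | s (m + l) = true ∧ trues s (m + l) = l} ∪
          (if m = 0 then (⋃ m, {s : ℕ → Bool | s (m + l) = true ∧ trues s (m + l) = l})ᶜ else ∅) := by
      ext s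
      by_cases h : ∃ m', s (m' + l) = true ∧ trues s (m' + l) = l
      · obtain ⟨m', h1, h2⟩ := h
        have hf := failureCount_eq h1 h2
        have hu : (s (m + l) = true ∧ trues s (m + l) = l) ↔ m' = m :=
          ⟨fun h => hf.symm.trans (failureCount_eq h.1 h.2), fun h => h ▸ ⟨h1, h2⟩⟩
        simp only [Set.mem_preimage, hf, Set.mem_singleton_iff, Set.mem_union, Set.mem_ofPred_eq, hu]
        refine ⟨Or.inl, fun h => h.resolve_right fun h => ?_⟩
        split_ifs at h
        · exact h (Set.mem_iUnion.2 ⟨m', h1, h2⟩)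
        · exact h
      · have hf := failureCount_eq_zero h
        push Not at h
        by_cases hm : m = 0
        · simp only [Set.mem_preimage, hf, hm, Set.mem_singleton_iff, true_iff, if_true]
          right
          simpa using h
        · simp only [Set.mem_preimage, hf, Set.mem_singleton_iff, hm, if_false, Set.union_empty,
            Set.mem_ofPred_eq]
          exact ⟨fun h => absurd h.symm hm, fun h' => absurd h'.2 (h m h'.1)⟩
    rw [this]
    refine (hE m).union ?_
    split_ifs
    · exact (MeasurableSet.iUnion hE).compl
    · exact .empty

/-- `s` has infinitely many `true` entries. -/
def ManyTrues (s : ℕ → Bool) : Prop := ∀ l, ∃ m, s (m + l) = true ∧ trues s (m + l) = l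

lemma ManyTrues.spec {s : ℕ → Bool} (h : ManyTrues s) (l : ℕ) :
    s (failureCount s (l + 1) + l) = true ∧ trues s (failureCount s (l + 1) + l) = l := by
  obtain ⟨m, h1, h2⟩ := h l
  rw [failureCount_eq h1 h2]
  exact ⟨h1, h2⟩

lemma trues_mono (s : ℕ → Bool) : Monotone (trues s) := Nat.count_monotone _

lemma ManyTrues.failureCount_mono {s : ℕ → Bool} (h : ManyTrues s) : Monotone (failureCount s) := by
  refine monotone_nat_of_le_succ fun r => ?_
  cases r with
  | zero => exact Nat.zero_le _
  | succ l =>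
    obtain ⟨h1, h2⟩ := h.spec l
    obtain ⟨h3, h4⟩ := h.spec (l + 1)
    by_contra! hlt
    have := trues_mono s (show failureCount s (l + 1 + 1) + (l + 1) ≤ failureCount s (l + 1) + l by
      omega)
    omega

/-- The number of left arrows at `x` before the `r`-th right arrow. -/
noncomputable def failures (ω : Arrows) (x : ℤ) (r : ℕ) : ℕ := failureCount (fun i => ω (x, i)) r

lemma measurable_failures (x : ℤ) (r : ℕ) : Measurable fun ω => failures ω x r :=
  (measurable_failureCount r).comp (measurable_column x 0)

lemma dependsOn_failures (x : ℤ) (r : ℕ) :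
    DependsOn (fun ω => failures ω x r) {a : ℤ × ℕ | a.1 = x} := by
  intro ω ω' h
  simp only [failures]
  congr 1
  funext i
  exact h (x, i) rfl

lemma arrowMeasure_success {q : ℕ → ℝ} (hq : ∀ j, q j ∈ Set.Ioo (0 : ℝ) 1) (x : ℤ) (l m : ℕ) :
    arrowMeasure q {ω | ω (x, m + l) = true ∧ trues (fun i => ω (x, i)) (m + l) = l} =
      ENNReal.ofReal (bbTrans q l m) := by
  have h1 := arrowMeasure_inter q (A := {ω | ω (x, m + l) = true})
    (B := {ω | trues (fun i => ω (x, i + 0)) (m + l) = l}) (measurableSet_arrow _ _)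
    ((measurable_trues (m + l)).comp (measurable_column x 0) (measurableSet_singleton l))
    (S := {(x, m + l)}) (T := {a | a.2 < m + l})
    (fun ω ω' h => by simp only [Set.mem_ofPred_eq, h (x, m + l) rfl])
    (fun ω ω' h => by
      have : trues (fun i => ω (x, i + 0)) (m + l) = trues (fun i => ω' (x, i + 0)) (m + l) :=
        trues_congr fun i hi => h (x, i) hi
      simp only [Set.mem_ofPred_eq, this])
    (by rw [Set.disjoint_singleton_left]; exact lt_irrefl (m + l))
  rw [arrowMeasure_trues hq, arrowMeasure_arrow hq, if_pos rfl] at h1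
  rw [bbTrans_eq, mul_comm, ENNReal.ofReal_mul (hq _).1.le]
  exact h1

lemma tsum_ofReal_bbTrans {q : ℕ → ℝ} (hq : ∀ j, q j ∈ Set.Ioo (0 : ℝ) 1) {M : ℕ}
    (hM : ∀ j, M ≤ j → q j = 1 / 2) (l : ℕ) : ∑' m, ENNReal.ofReal (bbTrans q l m) = 1 := by
  have h := hasSum_failLaw hM (l + 1)
  rw [← ENNReal.ofReal_tsum_of_nonneg (fun m => (bbTrans_pos hq l m).le) h.summable]
  have : ∑' m, bbTrans q l m = 1 := h.tsum_eq
  rw [this, ENNReal.ofReal_one]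

lemma ae_manyTrues {q : ℕ → ℝ} (hq : ∀ j, q j ∈ Set.Ioo (0 : ℝ) 1) {M : ℕ}
    (hM : ∀ j, M ≤ j → q j = 1 / 2) : ∀ᵐ ω ∂arrowMeasure q, ∀ x : ℤ, ManyTrues fun i => ω (x, i) := by
  rw [ae_all_iff]
  intro x
  simp only [ManyTrues]
  rw [ae_all_iff]
  intro l
  have hE : ∀ m, MeasurableSet {ω : Arrows | ω (x, m + l) = true ∧
      trues (fun i => ω (x, i)) (m + l) = l} := fun m =>
    (measurableSet_arrow _ _).inter
      ((measurable_trues (m + l)).comp (measurable_column x 0) (measurableSet_singleton l))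
  have : arrowMeasure q (⋃ m, {ω : Arrows | ω (x, m + l) = true ∧
      trues (fun i => ω (x, i)) (m + l) = l}) = 1 := by
    rw [measure_iUnion _ hE]
    · simp only [arrowMeasure_success hq]
      exact tsum_ofReal_bbTrans hq hM l
    · intro m m' hmm
      refine Set.disjoint_left.2 fun ω h h' => hmm ?_
      exact (failureCount_eq (s := fun i => ω (x, i)) h.1 h.2).symm.trans
        (failureCount_eq (s := fun i => ω (x, i)) h'.1 h'.2)
  have h2 := (mem_ae_iff_prob_eq_one (MeasurableSet.iUnion hE)).2 this
  filter_upwards [h2] with ω hω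
  simpa using hω

lemma arrowMeasure_failures_succ {q : ℕ → ℝ} (hq : ∀ j, q j ∈ Set.Ioo (0 : ℝ) 1) {M : ℕ}
    (hM : ∀ j, M ≤ j → q j = 1 / 2) (x : ℤ) (l m : ℕ) :
    arrowMeasure q {ω | failures ω x (l + 1) = m} = ENNReal.ofReal (bbTrans q l m) := by
  rw [← arrowMeasure_success hq x]
  refine measure_congr ?_
  filter_upwards [ae_manyTrues hq hM] with ω hω
  refine propext ⟨fun h => ?_, fun h => failureCount_eq (s := fun i => ω (x, i)) h.1 h.2⟩
  have := (hω x).spec l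
  have h' : failureCount (fun i => ω (x, i)) (l + 1) = m := h
  rwa [h'] at this

/-- The transition kernel of the backwards branching-like process. -/
noncomputable def bbKernel (q : ℕ → ℝ) (l m : ℕ) : ℝ≥0∞ := ENNReal.ofReal (bbTrans q l m)

/-- The backwards branching-like process run for `m` generations, started from `0` at the site
`x + m` and ending at `x`. -/
noncomputable def branching (ω : Arrows) : ℕ → ℤ → ℕ
  | 0, _ => 0
  | m + 1, x => failures ω x (branching ω m (x + 1) + 1)

lemma measurable_branching (m : ℕ) (x : ℤ) : Measurable fun ω => branching ω m x := by
  induction m generalizing x with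
  | zero => exact measurable_const
  | succ m ih =>
    refine measurable_to_countable' fun j => ?_
    have : (fun ω => branching ω (m + 1) x) ⁻¹' {j} =
        ⋃ l, {ω | branching ω m (x + 1) = l} ∩ {ω | failures ω x (l + 1) = j} := by
      ext ω
      simp [branching]
    rw [this]
    exact .iUnion fun l => (ih (x + 1) (measurableSet_singleton l)).inter
      (measurable_failures x (l + 1) (measurableSet_singleton j))

lemma dependsOn_branching (m : ℕ) (x : ℤ) :
    DependsOn (fun ω => branching ω m x) {a : ℤ × ℕ | x ≤ a.1} := by
  intro ω ω' h
  induction m generalizing x with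
  | zero => rfl
  | succ m ih =>
    have h1 : branching ω m (x + 1) = branching ω' m (x + 1) :=
      ih (x + 1) fun a (ha : x + 1 ≤ a.1) => h a (show x ≤ a.1 by omega)
    simp only [branching]
    rw [h1]
    exact dependsOn_failures x _ fun a (ha : a.1 = x) => h a (show x ≤ a.1 by omega)

lemma branching_mono {ω : Arrows} (hω : ∀ x : ℤ, ManyTrues fun i => ω (x, i)) (x : ℤ) :
    Monotone fun m => branching ω m x := by
  refine monotone_nat_of_le_succ fun m => ?_
  induction m generalizing x with
  | zero => exact Nat.zero_le _
  | succ m ih => exact (hω x).failureCount_mono (Nat.succ_le_succ (ih (x + 1)))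

lemma branching_shift (ω : Arrows) (m : ℕ) (x : ℤ) :
    branching (shiftArrows ω) m x = branching ω m (x + 1) := by
  induction m generalizing x with
  | zero => rfl
  | succ m ih => simp only [branching, ih]; rfl

lemma arrowMeasure_branching {q : ℕ → ℝ} (hq : ∀ j, q j ∈ Set.Ioo (0 : ℝ) 1) {M : ℕ}
    (hM : ∀ j, M ≤ j → q j = 1 / 2) (n : ℕ) (x : ℤ) (j : ℕ) :
    arrowMeasure q {ω | branching ω n x = j} = lawFromZero (bbKernel q) n j := by
  induction n generalizing x j with
  | zero =>
    by_cases hj : j = 0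
    · simp [branching, lawFromZero, hj]
    · simp [branching, lawFromZero, hj, Ne.symm hj]
  | succ n ih =>
    have : {ω | branching ω (n + 1) x = j} =
        ⋃ l, {ω | branching ω n (x + 1) = l} ∩ {ω | failures ω x (l + 1) = j} := by
      ext ω
      simp [branching]
    have hm1 : ∀ l, MeasurableSet {ω | branching ω n (x + 1) = l} := fun l =>
      measurable_branching n (x + 1) (measurableSet_singleton l)
    have hm2 : ∀ l, MeasurableSet {ω | failures ω x (l + 1) = j} := fun l =>
      measurable_failures x (l + 1) (measurableSet_singleton j)
    rw [this, measure_iUnion, lawFromZero]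
    · refine tsum_congr fun l => ?_
      rw [arrowMeasure_inter q (hm1 l) (hm2 l) (S := {a | x + 1 ≤ a.1}) (T := {a | a.1 = x}), ih,
        arrowMeasure_failures_succ hq hM, bbKernel]
      · intro ω ω' h
        simp only [Set.mem_ofPred_eq, dependsOn_branching n (x + 1) h]
      · intro ω ω' h
        simp only [Set.mem_ofPred_eq, dependsOn_failures x (l + 1) h]
      · exact Set.disjoint_left.2 fun a (h1 : x + 1 ≤ a.1) (h2 : a.1 = x) => by omega
    · intro l l' hl
      refine Set.disjoint_left.2 fun ω h h' => hl (h.1.symm.trans h'.1)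
    · exact fun l => (hm1 l).inter (hm2 l)

lemma measure_lt_eq_sum {α : Type*} [MeasurableSpace α] (μ : Measure α) {f : α → ℕ}
    (hf : Measurable f) (j : ℕ) : μ {a | f a < j} = ∑ i ∈ Finset.range j, μ {a | f a = i} := by
  have : {a | f a < j} = ⋃ i ∈ Finset.range j, {a | f a = i} := by ext; simp
  rw [this, measure_biUnion_finset]
  · intro i _ i' _ h
    exact Set.disjoint_left.2 fun a ha ha' => h (ha.symm.trans ha')
  · exact fun i _ => hf (measurableSet_singleton i)

lemma antitone_sum_lawFromZero {q : ℕ → ℝ} (hq : ∀ j, q j ∈ Set.Ioo (0 : ℝ) 1) {M : ℕ}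
    (hM : ∀ j, M ≤ j → q j = 1 / 2) (j : ℕ) :
    Antitone fun n => ∑ i ∈ Finset.range j, lawFromZero (bbKernel q) n i := by
  intro n n' hn
  simp only [← arrowMeasure_branching hq hM _ 0, ← measure_lt_eq_sum _ (measurable_branching _ _)]
  refine measure_mono_ae ?_
  filter_upwards [ae_manyTrues hq hM] with ω hω h
  exact lt_of_le_of_lt (branching_mono hω 0 hn) h

lemma exists_isStationaryDist {q : ℕ → ℝ} (hq : ∀ j, q j ∈ Set.Ioo (0 : ℝ) 1) {M : ℕ}
    (hM : ∀ j, M ≤ j → q j = 1 / 2) (hδ : 1 < ∑ j ∈ Finset.range M, (2 * q j - 1)) :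
    ∃ π, IsStationaryDist q π := by
  choose e he heM using fun l => exists_hasSum_mul_failLaw (q := q) hM (l + 1)
  simp only [failLaw] at he
  have he0 : ∀ l, 0 ≤ e l := fun l => (he l).nonneg fun m =>
    mul_nonneg m.cast_nonneg (bbTrans_pos hq l m).le
  have hmean : ∀ l, ∑' m : ℕ, bbKernel q l m * m = ENNReal.ofReal (e l) := by
    intro l
    rw [← (he l).tsum_eq, ENNReal.ofReal_tsum_of_nonneg
      (fun m => mul_nonneg m.cast_nonneg (bbTrans_pos hq l m).le) (he l).summable]
    refine tsum_congr fun m => ?_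
    rw [ENNReal.ofReal_mul m.cast_nonneg, ENNReal.ofReal_natCast, mul_comm]
    rfl
  set δ := ∑ j ∈ Finset.range M, (2 * q j - 1) with hδ'
  obtain ⟨ν, hν1, hν⟩ := exists_invariant_of_drift (κ := bbKernel q) (tsum_ofReal_bbTrans hq hM)
    (antitone_sum_lawFromZero hq hM) (ε := ENNReal.ofReal (δ - 1))
    (B := ∑ l ∈ Finset.range M, (ENNReal.ofReal (e l) + ENNReal.ofReal (δ - 1))) (M := M)
    (by simpa using hδ) ENNReal.ofReal_ne_top (by simp [ENNReal.sum_eq_top]) (by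
      intro l
      rw [hmean]
      split_ifs with hl
      · exact (Finset.single_le_sum (f := fun l => ENNReal.ofReal (e l) + ENNReal.ofReal (δ - 1))
          (fun _ _ => zero_le) (Finset.mem_range.2 hl)).trans le_add_self
      · rw [heM l (by omega), add_zero, ← ENNReal.ofReal_add, ← ENNReal.ofReal_natCast]
        · refine ENNReal.ofReal_le_ofReal ?_
          push_cast
          linarith
        · rw [← heM l (by omega)]; exact he0 l
        · linarith)
  have hfin : ∀ l, ν l ≠ ∞ := fun l =>
    ((ENNReal.le_tsum l).trans_lt (hν1.trans_lt ENNReal.one_lt_top)).ne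
  refine ⟨fun k => (ν k).toReal, fun k => ENNReal.toReal_nonneg, ?_, fun m => ?_⟩
  · rw [← ENNReal.tsum_toReal_eq hfin, hν1, ENNReal.toReal_one]
  · simp only
    rw [← hν m, ENNReal.tsum_toReal_eq]
    · refine tsum_congr fun l => ?_
      rw [ENNReal.toReal_mul, bbKernel, ENNReal.toReal_ofReal (bbTrans_pos hq l m).le]
    · exact fun l => ENNReal.mul_ne_top (hfin l) ENNReal.ofReal_ne_top

/-- The backwards branching-like process started in the infinite past, at the site `x`. -/
noncomputable def branchingLim (ω : Arrows) (x : ℤ) : ℕ := ⨆ m, branching ω m x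

lemma measurable_branchingLim (x : ℤ) : Measurable fun ω => branchingLim ω x :=
  Measurable.iSup fun m => measurable_branching m x

lemma dependsOn_branchingLim (x : ℤ) :
    DependsOn (fun ω => branchingLim ω x) {a : ℤ × ℕ | x ≤ a.1} := by
  intro ω ω' h
  simp only [branchingLim]
  exact iSup_congr fun m => dependsOn_branching m x h

lemma branchingLim_shift (ω : Arrows) (x : ℤ) :
    branchingLim (shiftArrows ω) x = branchingLim ω (x + 1) := by
  simp only [branchingLim, branching_shift]

/-- The configurations for which the limiting branching process is well behaved. -/
def Good (ω : Arrows) : Prop :=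
  (∀ x : ℤ, ManyTrues fun i => ω (x, i)) ∧ ∀ x, BddAbove (Set.range fun m => branching ω m x)

lemma Good.branching_le {ω : Arrows} (h : Good ω) (m : ℕ) (x : ℤ) :
    branching ω m x ≤ branchingLim ω x := le_ciSup (h.2 x) m

lemma Good.eventually_eq {ω : Arrows} (h : Good ω) (x : ℤ) :
    ∀ᶠ m in atTop, branching ω m x = branchingLim ω x := by
  obtain ⟨m, hm⟩ := Nat.sSup_mem (Set.range_nonempty fun m => branching ω m x) (h.2 x)
  filter_upwards [eventually_ge_atTop m] with n hn
  refine le_antisymm (h.branching_le n x) ?_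
  calc branchingLim ω x = branching ω m x := hm.symm
    _ ≤ _ := branching_mono h.1 x hn

lemma Good.branchingLim_eq {ω : Arrows} (h : Good ω) (x : ℤ) :
    branchingLim ω x = failures ω x (branchingLim ω (x + 1) + 1) := by
  obtain ⟨m, h1, h2⟩ := (((tendsto_add_atTop_nat 1).eventually (h.eventually_eq x)).and
    (h.eventually_eq (x + 1))).exists
  rw [← h1, branching, h2]

section
variable {q : ℕ → ℝ} {M : ℕ} {π : ℕ → ℝ}

lemma tendsto_lawFromZero (hq : ∀ j, q j ∈ Set.Ioo (0 : ℝ) 1)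
    (hM : ∀ j, M ≤ j → q j = 1 / 2) (h : IsStationaryDist q π) (m : ℕ) :
    Tendsto (fun n => lawFromZero (bbKernel q) n m) atTop (𝓝 (ENNReal.ofReal (π m))) := by
  obtain ⟨ν, hν⟩ := exists_tendsto_lawFromZero (κ := bbKernel q) (tsum_ofReal_bbTrans hq hM)
    (antitone_sum_lawFromZero hq hM)
  have := tendsto_eq_invariant (κ := bbKernel q) (π := fun m => ENNReal.ofReal (π m))
    (tsum_ofReal_bbTrans hq hM)
    (fun l m => by simpa [bbKernel] using bbTrans_pos hq l m)
    (by rw [← ENNReal.ofReal_tsum_of_nonneg h.1 h.summable, h.2.1, ENNReal.ofReal_one])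
    (fun m => by
      rw [h.2.2 m, ENNReal.ofReal_tsum_of_nonneg
        (fun l => mul_nonneg (h.1 l) (bbTrans_pos hq l m).le) (summable_stationary_mul hq hM h m)]
      exact tsum_congr fun l => (ENNReal.ofReal_mul (h.1 l)).symm)
    hν
  rw [this] at hν
  exact hν m

lemma arrowMeasure_branching_forall_lt (hq : ∀ j, q j ∈ Set.Ioo (0 : ℝ) 1)
    (hM : ∀ j, M ≤ j → q j = 1 / 2) (h : IsStationaryDist q π) (x : ℤ) (j : ℕ) :
    arrowMeasure q {ω | ∀ m, branching ω m x < j} =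
      ∑ i ∈ Finset.range j, ENNReal.ofReal (π i) := by
  have hm : ∀ m, MeasurableSet {ω | branching ω m x < j} := fun m =>
    measurableSet_lt (measurable_branching m x) measurable_const
  have h1 : Tendsto (fun n => arrowMeasure q {ω | ∀ m ≤ n, branching ω m x < j}) atTop
      (𝓝 (arrowMeasure q {ω | ∀ m, branching ω m x < j})) := by
    have : {ω | ∀ m, branching ω m x < j} = ⋂ n, {ω | ∀ m ≤ n, branching ω m x < j} := by
      ext ω
      simp only [Set.mem_ofPred_eq, Set.mem_iInter]
      exact ⟨fun h _ m _ => h m, fun h m => h m m le_rfl⟩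
    rw [this]
    refine tendsto_measure_iInter_atTop (fun n => ?_) ?_ ⟨0, measure_ne_top _ _⟩
    · have : {ω | ∀ m ≤ n, branching ω m x < j} = ⋂ m, ⋂ (_ : m ≤ n), {ω | branching ω m x < j} := by
        ext; simp
      rw [this]
      exact (MeasurableSet.iInter fun m => .iInter fun _ => hm m).nullMeasurableSet
    · exact fun n n' hn ω h m hmn => h m (hmn.trans hn)
  refine tendsto_nhds_unique h1 ?_
  have h2 : ∀ n, arrowMeasure q {ω | ∀ m ≤ n, branching ω m x < j} =
      ∑ i ∈ Finset.range j, lawFromZero (bbKernel q) n i := by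
    intro n
    simp only [← arrowMeasure_branching hq hM _ x, ← measure_lt_eq_sum _ (measurable_branching _ _)]
    refine measure_congr ?_
    filter_upwards [ae_manyTrues hq hM] with ω hω
    exact propext ⟨fun h => h n le_rfl, fun h m hm => (branching_mono hω x hm).trans_lt h⟩
  simp only [h2]
  exact tendsto_finsetSum _ fun i _ => tendsto_lawFromZero hq hM h i

lemma ae_good (hq : ∀ j, q j ∈ Set.Ioo (0 : ℝ) 1)
    (hM : ∀ j, M ≤ j → q j = 1 / 2) (h : IsStationaryDist q π) :
    ∀ᵐ ω ∂arrowMeasure q, Good ω := by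
  refine (ae_manyTrues hq hM).and (ae_all_iff.2 fun x => ?_)
  have hm : ∀ j, MeasurableSet {ω | ∀ m, branching ω m x < j} := fun j => by
    have : {ω | ∀ m, branching ω m x < j} = ⋂ m, {ω | branching ω m x < j} := by ext; simp
    rw [this]
    exact .iInter fun m => measurableSet_lt (measurable_branching m x) measurable_const
  have h1 : arrowMeasure q (⋃ j, {ω | ∀ m, branching ω m x < j}) = 1 := by
    refine le_antisymm prob_le_one ?_
    have h2 : Tendsto (fun j => ∑ i ∈ Finset.range j, ENNReal.ofReal (π i)) atTop (𝓝 1) := by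
      have := ENNReal.tendsto_nat_tsum fun i => ENNReal.ofReal (π i)
      rwa [← ENNReal.ofReal_tsum_of_nonneg h.1 h.summable, h.2.1, ENNReal.ofReal_one] at this
    refine le_of_tendsto' h2 fun j => ?_
    rw [← arrowMeasure_branching_forall_lt hq hM h x j]
    exact measure_mono (Set.subset_iUnion (fun j => {ω | ∀ m, branching ω m x < j}) j)
  filter_upwards [(mem_ae_iff_prob_eq_one (MeasurableSet.iUnion hm)).2 h1] with ω hω
  obtain ⟨j, hj⟩ := Set.mem_iUnion.1 hω
  exact ⟨j, by rintro _ ⟨m, rfl⟩; exact (hj m).le⟩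

lemma arrowMeasure_branchingLim (hq : ∀ j, q j ∈ Set.Ioo (0 : ℝ) 1)
    (hM : ∀ j, M ≤ j → q j = 1 / 2) (h : IsStationaryDist q π) (x : ℤ) (k : ℕ) :
    arrowMeasure q {ω | branchingLim ω x = k} = ENNReal.ofReal (π k) := by
  have h1 : ∀ j, ∑ i ∈ Finset.range j, arrowMeasure q {ω | branchingLim ω x = i} =
      ∑ i ∈ Finset.range j, ENNReal.ofReal (π i) := by
    intro j
    rw [← measure_lt_eq_sum _ (measurable_branchingLim x),
      ← arrowMeasure_branching_forall_lt hq hM h x]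
    refine measure_congr ?_
    filter_upwards [ae_good hq hM h] with ω hω
    refine propext ⟨fun h m => (hω.branching_le m x).trans_lt h, fun h => ?_⟩
    obtain ⟨m, hm⟩ := (hω.eventually_eq x).exists
    change branchingLim ω x < j
    rw [← hm]
    exact h m
  have h2 := h1 (k + 1)
  rw [Finset.sum_range_succ, Finset.sum_range_succ, h1 k] at h2
  exact (ENNReal.add_right_inj (by simp [ENNReal.sum_eq_top])).1 h2

end

/-- The running maximum of the Birkhoff sums of `f` along `T`, up to time `n`. -/
def maxBirkhoff {α : Type*} (T : α → α) (f : α → ℝ) : ℕ → α → ℝ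
  | 0, _ => 0
  | n + 1, x => max 0 (f x + maxBirkhoff T f n (T x))

section
variable {α : Type*} {T : α → α} {f : α → ℝ}

lemma maxBirkhoff_nonneg (n : ℕ) (x : α) : 0 ≤ maxBirkhoff T f n x := by
  cases n with
  | zero => exact le_rfl
  | succ n => exact le_max_left _ _

lemma maxBirkhoff_le_succ (n : ℕ) (x : α) : maxBirkhoff T f n x ≤ maxBirkhoff T f (n + 1) x := by
  induction n generalizing x with
  | zero => exact le_max_left _ _
  | succ n ih => exact max_le_max le_rfl (by linarith [ih (T x)])

lemma birkhoffSum_le_maxBirkhoff (n : ℕ) (x : α) : birkhoffSum T f n x ≤ maxBirkhoff T f n x := by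
  induction n generalizing x with
  | zero => simp [maxBirkhoff]
  | succ n ih =>
    rw [birkhoffSum_succ']
    exact le_max_of_le_right (by linarith [ih (T x)])

variable [MeasurableSpace α] {μ : Measure α}

lemma integrable_maxBirkhoff (hT : MeasurePreserving T μ μ) (hf : Integrable f μ) (n : ℕ) :
    Integrable (maxBirkhoff T f n) μ := by
  induction n with
  | zero => exact integrable_zero _ _ _
  | succ n ih => exact (integrable_zero _ _ _).sup (hf.add (hT.integrable_comp_of_integrable ih))

lemma measurable_maxBirkhoff (hT : Measurable T) (hf : Measurable f) (n : ℕ) :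
    Measurable (maxBirkhoff T f n) := by
  induction n with
  | zero => exact measurable_const
  | succ n ih => exact measurable_const.max (hf.add (ih.comp hT))

/-- The maximal ergodic lemma. -/
lemma setIntegral_maxBirkhoff_nonneg (hT : MeasurePreserving T μ μ) (hf : Integrable f μ)
    (hfm : Measurable f) (n : ℕ) : 0 ≤ ∫ x in {x | 0 < maxBirkhoff T f n x}, f x ∂μ := by
  set m := maxBirkhoff T f n with hm
  have hmi : Integrable m μ := integrable_maxBirkhoff hT hf n
  have hmT : Integrable (fun x => m (T x)) μ := hT.integrable_comp_of_integrable hmi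
  have hA : MeasurableSet {x | 0 < m x} :=
    measurableSet_lt measurable_const (measurable_maxBirkhoff hT.measurable hfm n)
  have h1 : ∀ x ∈ {x | 0 < m x}, m x - m (T x) ≤ f x := by
    intro x (hx : 0 < m x)
    cases n with
    | zero => exact absurd hx (lt_irrefl 0)
    | succ n =>
      have h2 : m x = max 0 (f x + maxBirkhoff T f n (T x)) := rfl
      have h3 : maxBirkhoff T f n (T x) ≤ m (T x) := maxBirkhoff_le_succ n (T x)
      rw [h2] at hx ⊢
      rw [max_eq_right_of_lt (by simpa using hx)]
      linarith
  calc 0 = ∫ x, m x ∂μ - ∫ x, m (T x) ∂μ := by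
        rw [← integral_map hT.measurable.aemeasurable (by rw [hT.map_eq]; exact hmi.1), hT.map_eq,
          sub_self]
    _ ≤ ∫ x in {x | 0 < m x}, m x ∂μ - ∫ x in {x | 0 < m x}, m (T x) ∂μ := by
        have e1 : ∫ x in {x | 0 < m x}, m x ∂μ = ∫ x, m x ∂μ := by
          refine setIntegral_eq_integral_of_forall_compl_eq_zero fun x hx => ?_
          exact le_antisymm (not_lt.1 hx) (maxBirkhoff_nonneg n x)
        have e2 : ∫ x in {x | 0 < m x}, m (T x) ∂μ ≤ ∫ x, m (T x) ∂μ :=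
          setIntegral_le_integral hmT (Eventually.of_forall fun x => maxBirkhoff_nonneg n (T x))
        linarith
    _ = ∫ x in {x | 0 < m x}, (m x - m (T x)) ∂μ :=
        (integral_sub hmi.integrableOn hmT.integrableOn).symm
    _ ≤ ∫ x in {x | 0 < m x}, f x ∂μ :=
        setIntegral_mono_on (hmi.sub hmT).integrableOn hf.integrableOn hA h1

lemma integral_nonneg_of_birkhoffSum_pos (hT : MeasurePreserving T μ μ) (hf : Integrable f μ)
    (hfm : Measurable f) (h : ∀ᵐ x ∂μ, ∃ n, 0 < birkhoffSum T f n x) : 0 ≤ ∫ x, f x ∂μ := by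
  have hmono : Monotone fun n => {x | 0 < maxBirkhoff T f n x} :=
    monotone_nat_of_le_succ fun n x (hx : 0 < _) => lt_of_lt_of_le hx (maxBirkhoff_le_succ n x)
  have h1 := tendsto_setIntegral_of_monotone (μ := μ) (f := f)
    (fun n => measurableSet_lt measurable_const (measurable_maxBirkhoff hT.measurable hfm n))
    hmono hf.integrableOn
  have h2 : ∫ x in ⋃ n, {x | 0 < maxBirkhoff T f n x}, f x ∂μ = ∫ x, f x ∂μ := by
    refine setIntegral_eq_integral_of_ae_compl_eq_zero ?_
    filter_upwards [h] with x ⟨n, hn⟩ hx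
    exact absurd (Set.mem_iUnion.2 ⟨n, hn.trans_le (birkhoffSum_le_maxBirkhoff n x)⟩) hx
  rw [h2] at h1
  exact ge_of_tendsto' h1 fun n => setIntegral_maxBirkhoff_nonneg hT hf hfm n

end

lemma shiftArrows_iterate (n : ℕ) (ω : Arrows) (a : ℤ × ℕ) :
    shiftArrows^[n] ω a = ω (a.1 + n, a.2) := by
  induction n generalizing a with
  | zero => simp
  | succ n ih =>
    rw [Function.iterate_succ_apply', shiftArrows, ih]
    congr 2
    push_cast
    ring

/-- Configurations whose Birkhoff averages exceed `b` infinitely often, by a definite margin. -/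
def exceeds (f : Arrows → ℝ) (b : ℝ) : Set Arrows :=
  {ω | ∃ c : ℚ, b < c ∧ ∃ᶠ n : ℕ in atTop, (c : ℝ) * n ≤ birkhoffSum shiftArrows f n ω}

lemma measurable_birkhoffSum_shift {f : Arrows → ℝ} (hf : Measurable f) (n : ℕ) :
    Measurable (birkhoffSum shiftArrows f n) := by
  have hT : Measurable shiftArrows := (measurePreserving_shiftArrows fun _ => 0).measurable
  exact Finset.measurable_fun_sum _ fun i _ => hf.comp (hT.iterate i)

lemma measurableSet_exceeds {f : Arrows → ℝ} (hf : Measurable f) (b : ℝ) :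
    MeasurableSet (exceeds f b) := by
  have : exceeds f b = ⋃ c : ℚ, ⋃ (_ : b < c), ⋂ N : ℕ, ⋃ n : ℕ, ⋃ (_ : N ≤ n),
      {ω | (c : ℝ) * n ≤ birkhoffSum shiftArrows f n ω} := by
    ext ω
    simp [exceeds, frequently_atTop]
  rw [this]
  exact .iUnion fun c => .iUnion fun _ => .iInter fun N => .iUnion fun n => .iUnion fun _ =>
    measurableSet_le measurable_const (measurable_birkhoffSum_shift hf n)

lemma exceeds_of_agree {f : Arrows → ℝ} (hf : DependsOn f {a : ℤ × ℕ | 0 ≤ a.1}) {b : ℝ} {k : ℤ}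
    {ω ω' : Arrows} (h : ∀ a ∈ {a : ℤ × ℕ | k ≤ a.1}, ω a = ω' a) (hω : ω ∈ exceeds f b) :
    ω' ∈ exceeds f b := by
  obtain ⟨c, hbc, hc⟩ := hω
  obtain ⟨c', h1, h2⟩ := exists_rat_btwn hbc
  refine ⟨c', h1, ?_⟩
  have heq : ∀ i, k.toNat ≤ i → f (shiftArrows^[i] ω) = f (shiftArrows^[i] ω') := by
    intro i hi
    refine hf fun a (ha : 0 ≤ a.1) => ?_
    rw [shiftArrows_iterate, shiftArrows_iterate]
    exact h _ (show k ≤ a.1 + i by omega)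
  set C := birkhoffSum shiftArrows f k.toNat ω - birkhoffSum shiftArrows f k.toNat ω' with hC
  have hdiff : ∀ n, k.toNat ≤ n →
      birkhoffSum shiftArrows f n ω - birkhoffSum shiftArrows f n ω' = C := by
    intro n hn
    induction n, hn using Nat.le_induction with
    | base => rfl
    | succ n hn ih => rw [birkhoffSum_succ, birkhoffSum_succ, heq n hn]; linarith
  have hev : ∀ᶠ n : ℕ in atTop, C ≤ ((c : ℝ) - c') * n := by
    have : Tendsto (fun n : ℕ => ((c : ℝ) - c') * n) atTop atTop :=
      tendsto_natCast_atTop_atTop.const_mul_atTop (sub_pos.2 h2)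
    exact this.eventually_ge_atTop C
  refine (hc.and_eventually (hev.and (eventually_ge_atTop k.toNat))).mono ?_
  rintro n ⟨h3, h4, h5⟩
  linarith [hdiff n h5]

lemma ae_not_exceeds (q : ℕ → ℝ) {f : Arrows → ℝ} (hf : Measurable f)
    (hd : DependsOn f {a : ℤ × ℕ | 0 ≤ a.1}) (hi : Integrable f (arrowMeasure q)) {b : ℝ}
    (hb : ∫ ω, f ω ∂arrowMeasure q < b) : ∀ᵐ ω ∂arrowMeasure q, ω ∉ exceeds f b := by
  rcases zero_or_one_of_dependsOn q (measurableSet_exceeds hf b) (fun k ω ω' h =>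
    propext ⟨exceeds_of_agree hd h, exceeds_of_agree hd fun a ha => (h a ha).symm⟩) with h | h
  · exact measure_eq_zero_iff_ae_notMem.1 h
  · exfalso
    have h1 := (mem_ae_iff_prob_eq_one (measurableSet_exceeds hf b)).2 h
    have := integral_nonneg_of_birkhoffSum_pos (measurePreserving_shiftArrows q)
      (hi.sub (integrable_const b)) (hf.sub measurable_const) (by
        filter_upwards [h1] with ω ⟨c, hbc, hc⟩
        obtain ⟨n, h2, h3⟩ := (hc.and_eventually (eventually_gt_atTop 0)).exists
        refine ⟨n, ?_⟩
        have h4 : birkhoffSum shiftArrows (f - fun _ => b) n ω =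
            birkhoffSum shiftArrows f n ω - n * b := by
          simp [birkhoffSum]
        rw [h4]
        have : (0 : ℝ) < n := by exact_mod_cast h3
        nlinarith)
    rw [integral_sub' hi (integrable_const b)] at this
    simp at this
    linarith

lemma ae_eventually_birkhoffSum_le (q : ℕ → ℝ) {f : Arrows → ℝ} (hf : Measurable f)
    (hd : DependsOn f {a : ℤ × ℕ | 0 ≤ a.1}) (hi : Integrable f (arrowMeasure q)) :
    ∀ᵐ ω ∂arrowMeasure q, ∀ c : ℝ, ∫ ω, f ω ∂arrowMeasure q < c →
      ∀ᶠ n : ℕ in atTop, birkhoffSum shiftArrows f n ω < c * n := by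
  have h : ∀ᵐ ω ∂arrowMeasure q, ∀ b : ℚ, ∫ ω, f ω ∂arrowMeasure q < b → ω ∉ exceeds f b :=
    ae_all_iff.2 fun b => by
      by_cases hb : ∫ ω, f ω ∂arrowMeasure q < b
      · filter_upwards [ae_not_exceeds q hf hd hi hb] with ω h _ using h
      · exact Eventually.of_forall fun ω h => absurd h hb
  filter_upwards [h] with ω hω c hc
  obtain ⟨d, hd1, hd2⟩ := exists_rat_btwn hc
  obtain ⟨b, hb1, hb2⟩ := exists_rat_btwn hd1
  have h1 := hω b hb1
  have h2 : ¬ ∃ᶠ n : ℕ in atTop, (d : ℝ) * n ≤ birkhoffSum shiftArrows f n ω :=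
    fun h => h1 ⟨d, hb2, h⟩
  rw [not_frequently] at h2
  filter_upwards [h2] with n hn
  refine (not_le.1 hn).trans_le ?_
  gcongr

/-- The strong law for functions of the configuration to the right of the origin. -/
lemma ae_tendsto_birkhoffSum (q : ℕ → ℝ) {f : Arrows → ℝ} (hf : Measurable f)
    (hd : DependsOn f {a : ℤ × ℕ | 0 ≤ a.1}) (hi : Integrable f (arrowMeasure q)) :
    ∀ᵐ ω ∂arrowMeasure q, Tendsto (fun n : ℕ => birkhoffSum shiftArrows f n ω / n) atTop
      (𝓝 (∫ ω, f ω ∂arrowMeasure q)) := by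
  filter_upwards [ae_eventually_birkhoffSum_le q hf hd hi,
    ae_eventually_birkhoffSum_le q hf.neg
      (fun ω ω' h => by simp only [Pi.neg_apply, hd h]) hi.neg] with ω h1 h2
  rw [tendsto_order]
  constructor
  · intro a ha
    filter_upwards [h2 (-a) (by simpa [integral_neg] using ha), eventually_gt_atTop 0] with n hn h0
    have h0' : (0 : ℝ) < n := by exact_mod_cast h0
    rw [lt_div_iff₀ h0']
    have : birkhoffSum shiftArrows (-f) n ω = - birkhoffSum shiftArrows f n ω := by
      simp [birkhoffSum]
    rw [this] at hn
    linarith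
  · intro a ha
    filter_upwards [h1 a ha, eventually_gt_atTop 0] with n hn h0
    have h0' : (0 : ℝ) < n := by exact_mod_cast h0
    rwa [div_lt_iff₀ h0']

lemma branchingLim_iterate (n : ℕ) (ω : Arrows) (x : ℤ) :
    branchingLim (shiftArrows^[n] ω) x = branchingLim ω (x + n) := by
  induction n generalizing x with
  | zero => simp
  | succ n ih =>
    rw [Function.iterate_succ_apply', branchingLim_shift, ih]
    congr 1
    push_cast
    ring

section
variable {q : ℕ → ℝ} {M : ℕ} {π : ℕ → ℝ}

lemma lintegral_branchingLim (hq : ∀ j, q j ∈ Set.Ioo (0 : ℝ) 1)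
    (hM : ∀ j, M ≤ j → q j = 1 / 2) (h : IsStationaryDist q π) (φ : ℕ → ℝ≥0) :
    ∫⁻ ω, (φ (branchingLim ω 0) : ℝ≥0∞) ∂arrowMeasure q =
      ∑' k, (φ k : ℝ≥0∞) * ENNReal.ofReal (π k) := by
  have hφ : Measurable fun k => (φ k : ℝ≥0∞) := measurable_from_top
  rw [← lintegral_map (f := fun k => (φ k : ℝ≥0∞)) hφ (measurable_branchingLim 0),
    lintegral_countable']
  refine tsum_congr fun k => ?_
  rw [Measure.map_apply (measurable_branchingLim 0) (measurableSet_singleton k),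
    ← arrowMeasure_branchingLim hq hM h 0 k]
  rfl

lemma ae_tendsto_average (hq : ∀ j, q j ∈ Set.Ioo (0 : ℝ) 1)
    (hM : ∀ j, M ≤ j → q j = 1 / 2) (h : IsStationaryDist q π) (φ : ℕ → ℝ≥0)
    (hφ : ∑' k, (φ k : ℝ≥0∞) * ENNReal.ofReal (π k) ≠ ∞) :
    ∀ᵐ ω ∂arrowMeasure q, Tendsto
      (fun n : ℕ => (∑ k ∈ Finset.range n, (φ (branchingLim ω k) : ℝ≥0∞)) / n) atTop
      (𝓝 (∑' k, (φ k : ℝ≥0∞) * ENNReal.ofReal (π k))) := by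
  rw [← lintegral_branchingLim hq hM h] at hφ ⊢
  have hm : Measurable fun ω => (φ (branchingLim ω 0) : ℝ) :=
    (measurable_from_top (f := fun k => (φ k : ℝ))).comp (measurable_branchingLim 0)
  have hm' : Measurable fun ω => (φ (branchingLim ω 0) : ℝ≥0∞) :=
    (measurable_from_top (f := fun k => (φ k : ℝ≥0∞))).comp (measurable_branchingLim 0)
  have hi : Integrable (fun ω => (φ (branchingLim ω 0) : ℝ)) (arrowMeasure q) :=
    integrable_toReal_of_lintegral_ne_top hm'.aemeasurable hφ
  have hint : ∫ ω, (φ (branchingLim ω 0) : ℝ) ∂arrowMeasure q =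
      (∫⁻ ω, (φ (branchingLim ω 0) : ℝ≥0∞) ∂arrowMeasure q).toReal :=
    integral_toReal hm'.aemeasurable (Eventually.of_forall fun ω => ENNReal.coe_lt_top)
  filter_upwards [ae_tendsto_birkhoffSum q hm
    (fun ω ω' h => by simp only [dependsOn_branchingLim 0 h]) hi] with ω hω
  have h2 := (ENNReal.continuous_ofReal.tendsto _).comp hω
  rw [hint, ENNReal.ofReal_toReal hφ] at h2
  refine h2.congr fun n => ?_
  rcases n.eq_zero_or_pos with rfl | hn
  · simp
  · simp only [Function.comp_apply]
    rw [ENNReal.ofReal_div_of_pos (by exact_mod_cast hn), ENNReal.ofReal_natCast]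
    congr 1
    rw [birkhoffSum, ENNReal.ofReal_sum_of_nonneg fun _ _ => NNReal.coe_nonneg _]
    refine Finset.sum_congr rfl fun k _ => ?_
    rw [branchingLim_iterate, zero_add, ENNReal.ofReal_coe_nnreal]

lemma ae_tendsto_average_id (hq : ∀ j, q j ∈ Set.Ioo (0 : ℝ) 1)
    (hM : ∀ j, M ≤ j → q j = 1 / 2) (h : IsStationaryDist q π) :
    ∀ᵐ ω ∂arrowMeasure q, Tendsto
      (fun n : ℕ => (∑ k ∈ Finset.range n, (branchingLim ω k : ℝ≥0∞)) / n) atTop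
      (𝓝 (∑' k : ℕ, (k : ℝ≥0∞) * ENNReal.ofReal (π k))) := by
  have hπ1 : ∑' k, ENNReal.ofReal (π k) = 1 := by
    rw [← ENNReal.ofReal_tsum_of_nonneg h.1 h.summable, h.2.1, ENNReal.ofReal_one]
  by_cases hfin : ∑' k : ℕ, (k : ℝ≥0∞) * ENNReal.ofReal (π k) = ∞
  · have hK : ∀ K : ℕ, ∑' k : ℕ, (((min k K : ℕ) : ℝ≥0) : ℝ≥0∞) * ENNReal.ofReal (π k) ≠ ∞ := by
      intro K
      refine ne_top_of_le_ne_top (b := ∑' k : ℕ, (K : ℝ≥0∞) * ENNReal.ofReal (π k)) ?_ ?_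
      · rw [ENNReal.tsum_mul_left, hπ1]; simp
      · refine ENNReal.tsum_le_tsum fun k => ?_
        gcongr
        rw [ENNReal.coe_natCast]
        exact_mod_cast min_le_right k K
    filter_upwards [ae_all_iff.2 fun K : ℕ => ae_tendsto_average hq hM h
      (fun k => ((min k K : ℕ) : ℝ≥0)) (hK K)] with ω hω
    rw [hfin, ENNReal.tendsto_nhds_top_iff_nat]
    intro N
    have hex : ∃ K : ℕ, (N : ℝ≥0∞) <
        ∑' k : ℕ, (((min k K : ℕ) : ℝ≥0) : ℝ≥0∞) * ENNReal.ofReal (π k) := by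
      have h1 : Tendsto (fun K => ∑ k ∈ Finset.range K, (k : ℝ≥0∞) * ENNReal.ofReal (π k)) atTop
          (𝓝 ∞) := by
        rw [← hfin]; exact ENNReal.tendsto_nat_tsum _
      obtain ⟨K, hK⟩ := ((ENNReal.tendsto_nhds_top_iff_nat.1 h1) N).exists
      refine ⟨K, hK.trans_le ?_⟩
      refine le_trans (Finset.sum_le_sum fun k hk => ?_) (ENNReal.sum_le_tsum (Finset.range K))
      rw [min_eq_left (Finset.mem_range.1 hk).le, ENNReal.coe_natCast]
    obtain ⟨K, hK⟩ := hex
    filter_upwards [(tendsto_order.1 (hω K)).1 _ hK] with n hn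
    refine hn.trans_le ?_
    gcongr
    rw [ENNReal.coe_natCast]
    exact_mod_cast min_le_left _ K
  · have := ae_tendsto_average hq hM h (fun k => (k : ℝ≥0)) (by simpa using hfin)
    simpa using this

lemma ae_tendsto_speed (hq : ∀ j, q j ∈ Set.Ioo (0 : ℝ) 1)
    (hM : ∀ j, M ≤ j → q j = 1 / 2) (h : IsStationaryDist q π) :
    ∀ᵐ ω ∂arrowMeasure q, Tendsto
      (fun n : ℕ => (n : ℝ) / (n + 2 * ∑ k ∈ Finset.range n, (branchingLim ω k : ℝ))) atTop
      (𝓝 (((1 : ℝ≥0∞) + 2 * (∑' k : ℕ, (k : ℝ≥0∞) * ENNReal.ofReal (π k)))⁻¹.toReal)) := by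
  filter_upwards [ae_tendsto_average_id hq hM h] with ω hω
  have h1 := tendsto_inv_iff.2
    (tendsto_const_nhds.add (ENNReal.Tendsto.const_mul (a := 2) hω (Or.inr (by simp)))
      (a := (1 : ℝ≥0∞)))
  have h2 := (ENNReal.tendsto_toReal (by simp)).comp h1
  refine h2.congr' ?_
  filter_upwards [eventually_gt_atTop 0] with n hn
  have hn' : (n : ℝ) ≠ 0 := by positivity
  simp only [Function.comp_apply, ENNReal.toReal_inv]
  rw [ENNReal.toReal_add (by simp) (by
    refine ENNReal.mul_ne_top (by simp) (ENNReal.div_ne_top (by simp [ENNReal.sum_eq_top]) ?_)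
    exact_mod_cast hn.ne')]
  rw [ENNReal.toReal_mul, ENNReal.toReal_div, ENNReal.toReal_sum (by simp)]
  simp only [ENNReal.toReal_one, ENNReal.toReal_ofNat, ENNReal.toReal_natCast]
  rw [← inv_div]
  field_simp

lemma ae_tendsto_zeros (hq : ∀ j, q j ∈ Set.Ioo (0 : ℝ) 1)
    (hM : ∀ j, M ≤ j → q j = 1 / 2) (h : IsStationaryDist q π) :
    ∀ᵐ ω ∂arrowMeasure q, Tendsto
      (fun n : ℕ => (∑ k ∈ Finset.range n, if branchingLim ω k = 0 then (1 : ℝ) else 0) / n) atTop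
      (𝓝 (π 0)) := by
  have hs : ∑' k : ℕ, (((if k = 0 then 1 else 0 : ℝ≥0)) : ℝ≥0∞) * ENNReal.ofReal (π k) =
      ENNReal.ofReal (π 0) := by
    rw [tsum_eq_single 0 fun k hk => by simp [hk]]
    simp
  filter_upwards [ae_tendsto_average hq hM h (fun k => if k = 0 then 1 else 0)
    (by rw [hs]; exact ENNReal.ofReal_ne_top)] with ω hω
  rw [hs] at hω
  have h2 := (ENNReal.tendsto_toReal ENNReal.ofReal_ne_top).comp hω
  rw [ENNReal.toReal_ofReal (h.1 0)] at h2
  refine h2.congr fun n => ?_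
  simp only [Function.comp_apply]
  rw [ENNReal.toReal_div, ENNReal.toReal_sum (by simp), ENNReal.toReal_natCast]
  congr 1
  refine Finset.sum_congr rfl fun k _ => ?_
  split_ifs <;> simp

lemma exists_zero_between {Z : ℕ → ℕ} {ρ : ℝ} (hρ : 0 < ρ)
    (h : Tendsto (fun n : ℕ => (∑ k ∈ Finset.range n, if Z k = 0 then (1 : ℝ) else 0) / n) atTop
      (𝓝 ρ)) {ε : ℝ} (hε : 0 < ε) :
    ∀ᶠ n : ℕ in atTop, ∃ j, Z j = 0 ∧ n ≤ j ∧ (j : ℝ) ≤ (1 + ε) * n := by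
  set c : ℕ → ℝ := fun n => ∑ k ∈ Finset.range n, if Z k = 0 then (1 : ℝ) else 0 with hc
  set η := ρ * ε / (2 + ε) with hη
  have hη0 : 0 < η := by positivity
  have hη2 : η * (2 + ε) = ρ * ε := by rw [hη]; field_simp
  have hηρ : η < ρ := by
    rw [hη, div_lt_iff₀ (by positivity)]; nlinarith
  obtain ⟨N, hN⟩ := eventually_atTop.1
    (((tendsto_order.1 h).1 (ρ - η) (by linarith)).and ((tendsto_order.1 h).2 (ρ + η) (by linarith)))
  filter_upwards [eventually_ge_atTop N, eventually_gt_atTop 0] with n hn hn0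
  by_contra hno
  push Not at hno
  set m := ⌊(1 + ε) * n⌋₊ + 1 with hm
  have hmlt : (1 + ε) * n < m := by
    rw [hm]; push_cast; exact Nat.lt_floor_add_one _
  have hn0' : (0 : ℝ) < n := by exact_mod_cast hn0
  have hnm : n ≤ m := by
    have : (n : ℝ) ≤ m := by nlinarith
    exact_mod_cast this
  have hm0' : (0 : ℝ) < m := hn0'.trans_le (by exact_mod_cast hnm)
  have hcm : c m = c n := by
    simp only [hc]
    rw [← Finset.sum_range_add_sum_Ico _ hnm]
    simp only [add_eq_left]
    refine Finset.sum_eq_zero fun j hj => ?_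
    rw [Finset.mem_Ico] at hj
    rw [if_neg]
    intro h0
    have := hno j h0 hj.1
    have h3 : (j : ℝ) ≤ ⌊(1 + ε) * n⌋₊ := by
      have : j ≤ ⌊(1 + ε) * n⌋₊ := by omega
      exact_mod_cast this
    linarith [Nat.floor_le (show 0 ≤ (1 + ε) * n by positivity)]
  have h1 := (hN m (hn.trans hnm)).1
  have h2 := (hN n hn).2
  rw [lt_div_iff₀ hm0'] at h1
  rw [div_lt_iff₀ hn0'] at h2
  have h3 : (ρ - η) * m < (ρ + η) * n := by
    calc _ < c m := h1
      _ = c n := hcm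
      _ < _ := h2
  nlinarith [mul_lt_mul_of_pos_left hmlt (sub_pos.2 hηρ)]

lemma ae_exists_zero_nonpos (hq : ∀ j, q j ∈ Set.Ioo (0 : ℝ) 1)
    (hM : ∀ j, M ≤ j → q j = 1 / 2) (h : IsStationaryDist q π) :
    ∀ᵐ ω ∂arrowMeasure q, ∃ x ≤ 0, branchingLim ω x = 0 := by
  set A : ℕ → Set Arrows := fun k => {ω | ∃ x ≤ (k : ℤ), branchingLim ω x = 0} with hA
  have hAm : ∀ k, MeasurableSet (A k) := by
    intro k
    have : A k = ⋃ x : ℤ, ⋃ (_ : x ≤ k), {ω | branchingLim ω x = 0} := by ext; simp [hA]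
    rw [this]
    exact .iUnion fun x => .iUnion fun _ => measurable_branchingLim x (measurableSet_singleton 0)
  have hconst : ∀ k, arrowMeasure q (A k) = arrowMeasure q (A 0) := by
    intro k
    induction k with
    | zero => rfl
    | succ k ih =>
      rw [← ih, ← (measurePreserving_shiftArrows q).measure_preimage (hAm k).nullMeasurableSet]
      congr 1
      ext ω
      simp only [hA, Set.mem_preimage, Set.mem_ofPred_eq, branchingLim_shift]
      constructor
      · rintro ⟨x, hx, h0⟩
        exact ⟨x - 1, by push_cast at hx; omega, by rwa [sub_add_cancel]⟩
      · rintro ⟨x, hx, h0⟩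
        exact ⟨x + 1, by push_cast; omega, h0⟩
  have hmono : Monotone A := fun k l hkl ω ⟨x, hx, h0⟩ => ⟨x, hx.trans (by exact_mod_cast hkl), h0⟩
  have hU : arrowMeasure q (⋃ k, A k) = 1 := by
    refine (mem_ae_iff_prob_eq_one (MeasurableSet.iUnion hAm)).1 ?_
    filter_upwards [ae_tendsto_zeros hq hM h] with ω hω
    obtain ⟨n, j, hj, -⟩ := (exists_zero_between (Z := fun k => branchingLim ω k)
      (h.pos hq hM 0) hω one_pos).exists
    exact Set.mem_iUnion.2 ⟨j, j, le_rfl, hj⟩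
  have h1 : Tendsto (fun k => arrowMeasure q (A k)) atTop (𝓝 1) := by
    rw [← hU]; exact tendsto_measure_iUnion_atTop hmono
  have h2 : arrowMeasure q (A 0) = 1 := by
    simp only [hconst] at h1
    exact tendsto_nhds_unique tendsto_const_nhds h1
  filter_upwards [(mem_ae_iff_prob_eq_one (hAm 0)).2 h2] with ω ⟨x, hx, h0⟩
  exact ⟨x, by simpa using hx, h0⟩

end

/-- The position of the walk following the arrows `ω`, with the number of departures from each
site so far. -/
def walkState (ω : Arrows) : ℕ → ℤ × (ℤ → ℕ)
  | 0 => (0, fun _ => 0)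
  | n + 1 =>
    ((walkState ω n).1 + if ω ((walkState ω n).1, (walkState ω n).2 (walkState ω n).1) then 1 else -1,
      Function.update (walkState ω n).2 (walkState ω n).1
        ((walkState ω n).2 (walkState ω n).1 + 1))

/-- The position at time `n` of the walk following the arrows `ω`. -/
def walk (ω : Arrows) (n : ℕ) : ℤ := (walkState ω n).1

/-- The number of departures from `x` before time `n`. -/
def departures (ω : Arrows) (n : ℕ) (x : ℤ) : ℕ := (walkState ω n).2 x

/-- The number of steps to the right from `x` before time `n`. -/
def rightSteps (ω : Arrows) (n : ℕ) (x : ℤ) : ℕ := trues (fun i => ω (x, i)) (departures ω n x)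

/-- The number of steps to the left from `x` before time `n`. -/
def leftSteps (ω : Arrows) (n : ℕ) (x : ℤ) : ℕ := departures ω n x - rightSteps ω n x

section
variable (ω : Arrows)

lemma walk_zero : walk ω 0 = 0 := rfl

lemma departures_zero (x : ℤ) : departures ω 0 x = 0 := rfl

lemma walk_succ (n : ℕ) :
    walk ω (n + 1) = walk ω n + if ω (walk ω n, departures ω n (walk ω n)) then 1 else -1 := rfl

lemma departures_succ (n : ℕ) (x : ℤ) :
    departures ω (n + 1) x = departures ω n x + if x = walk ω n then 1 else 0 := by
  change Function.update (walkState ω n).2 (walkState ω n).1 _ x = _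
  by_cases h : x = walk ω n
  · subst h
    rw [if_pos rfl]
    exact Function.update_self ..
  · rw [if_neg h, add_zero]
    exact Function.update_of_ne h ..

lemma rightSteps_add_leftSteps (n : ℕ) (x : ℤ) :
    rightSteps ω n x + leftSteps ω n x = departures ω n x :=
  Nat.add_sub_of_le (trues_le _ _)

lemma rightSteps_succ (n : ℕ) (x : ℤ) :
    rightSteps ω (n + 1) x = rightSteps ω n x +
      if x = walk ω n ∧ ω (walk ω n, departures ω n (walk ω n)) = true then 1 else 0 := by
  by_cases h : x = walk ω n
  · subst h
    simp [rightSteps, departures_succ, trues_succ]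
  · simp [rightSteps, departures_succ, h]

lemma leftSteps_succ (n : ℕ) (x : ℤ) :
    leftSteps ω (n + 1) x = leftSteps ω n x +
      if x = walk ω n ∧ ω (walk ω n, departures ω n (walk ω n)) = false then 1 else 0 := by
  have h1 := rightSteps_add_leftSteps ω n x
  have h2 := rightSteps_add_leftSteps ω (n + 1) x
  rw [rightSteps_succ, departures_succ] at h2
  by_cases h : x = walk ω n
  · cases hb : ω (walk ω n, departures ω n (walk ω n)) <;> simp [h, hb] at h1 h2 ⊢ <;> omega
  · simp [h] at h2 ⊢; omega

lemma rightSteps_zero (x : ℤ) : rightSteps ω 0 x = 0 := rfl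

lemma leftSteps_zero (x : ℤ) : leftSteps ω 0 x = 0 := rfl

lemma rightSteps_mono (x : ℤ) : Monotone fun n => rightSteps ω n x :=
  monotone_nat_of_le_succ fun n => by rw [rightSteps_succ]; exact Nat.le_add_right _ _

lemma rightSteps_sub_leftSteps (n : ℕ) (k : ℤ) :
    (rightSteps ω n k : ℤ) - leftSteps ω n (k + 1) =
      (if k < walk ω n then 1 else 0) - if k < 0 then 1 else 0 := by
  induction n with
  | zero => rw [rightSteps_zero, leftSteps_zero, walk_zero]; simp
  | succ n ih =>
    rw [rightSteps_succ, leftSteps_succ, walk_succ]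
    generalize ω (walk ω n, departures ω n (walk ω n)) = b at *
    cases b <;> simp only [Bool.false_eq_true, and_false, and_true, if_false, if_true, reduceCtorEq,
      add_zero] <;> push_cast <;> split_ifs at ih ⊢ <;> omega

lemma arrow_eq_true_of_lt_walk (n : ℕ) (k : ℤ) (hk : k < walk ω n) {c : ℕ}
    (hc : departures ω n k = c + 1) : ω (k, c) = true := by
  induction n generalizing c with
  | zero => simp [departures_zero] at hc
  | succ n ih =>
    rw [departures_succ] at hc
    rw [walk_succ] at hk
    by_cases h : k = walk ω n
    · subst h
      rw [if_pos rfl] at hc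
      obtain rfl : departures ω n (walk ω n) = c := by omega
      by_contra hb
      rw [if_neg hb] at hk
      omega
    · rw [if_neg h] at hc
      refine ih ?_ hc
      split_ifs at hk <;> omega

lemma walk_le (n : ℕ) : walk ω n ≤ n := by
  induction n with
  | zero => simp [walk_zero]
  | succ n ih => rw [walk_succ]; split_ifs <;> push_cast <;> omega

lemma departures_eq_zero {n : ℕ} {x : ℤ} (h : ∀ m < n, walk ω m ≠ x) : departures ω n x = 0 := by
  induction n with
  | zero => rfl
  | succ n ih =>
    rw [departures_succ, ih fun m hm => h m (by omega), if_neg (h n (by omega)).symm]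

lemma leftSteps_le_departures (n : ℕ) (x : ℤ) : leftSteps ω n x ≤ departures ω n x :=
  Nat.sub_le _ _

lemma leftSteps_eq_zero_of_le {n : ℕ} {x : ℤ} (h : (n : ℤ) ≤ x) : leftSteps ω n x = 0 := by
  have : departures ω n x = 0 := departures_eq_zero ω fun m hm => by
    have := walk_le ω m; omega
  have h2 := leftSteps_le_departures ω n x
  omega

lemma sum_departures_le (a : ℤ) (N n : ℕ) :
    ∑ i ∈ Finset.range N, departures ω n (i + a) ≤ n := by
  induction n with
  | zero => simp [departures_zero]
  | succ n ih =>
    simp only [departures_succ, Finset.sum_add_distrib]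
    refine add_le_add ih ?_
    rw [← Finset.card_filter]
    refine Finset.card_le_one.2 fun i hi j hj => ?_
    simp only [Finset.mem_filter] at hi hj
    omega

lemma sum_departures_eq {a : ℤ} {N n : ℕ} (h : ∀ m < n, a ≤ walk ω m ∧ walk ω m < N + a) :
    ∑ i ∈ Finset.range N, departures ω n (i + a) = n := by
  induction n with
  | zero => simp [departures_zero]
  | succ n ih =>
    simp only [departures_succ, Finset.sum_add_distrib]
    rw [ih fun m hm => h m (by omega)]
    congr 1
    obtain ⟨h1, h2⟩ := h n (by omega)
    rw [Finset.sum_eq_single (walk ω n - a).toNat]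
    · rw [if_pos (by omega)]
    · intro i _ hi
      rw [if_neg (by omega)]
    · intro hi
      exact absurd (Finset.mem_range.2 (by omega)) hi

end

lemma ManyTrues.sub_trues_le {s : ℕ → Bool} (h : ManyTrues s) (c : ℕ) :
    c - trues s c ≤ failureCount s (trues s c + 1) := by
  obtain ⟨h1, h2⟩ := h.spec (trues s c)
  by_contra! hlt
  have h3 := trues_mono s (show failureCount s (trues s c + 1) + trues s c + 1 ≤ c by omega)
  rw [trues_succ, h2, h1] at h3
  simp at h3

lemma sub_trues_eq {s : ℕ → Bool} {c : ℕ} (h : s c = true) :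
    c + 1 - trues s (c + 1) = failureCount s (trues s (c + 1)) := by
  have h1 := trues_le s c
  have h2 : trues s (c + 1) = trues s c + 1 := by rw [trues_succ, h, if_pos rfl]
  have h3 : c - trues s c + trues s c = c := Nat.sub_add_cancel h1
  rw [h2, failureCount_eq (m := c - trues s c) (by rwa [h3]) (by rw [h3])]
  omega

lemma leftSteps_of_lt_walk (ω : Arrows) (n : ℕ) {k : ℤ} (hk : k < walk ω n) :
    leftSteps ω n k = failures ω k (rightSteps ω n k) := by
  rw [leftSteps, rightSteps, failures]
  cases hc : departures ω n k with
  | zero => rfl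
  | succ c => exact sub_trues_eq (s := fun i => ω (k, i)) (arrow_eq_true_of_lt_walk ω n k hk hc)

lemma Good.leftSteps_le_failures {ω : Arrows} (h : Good ω) (n : ℕ) (k : ℤ) :
    leftSteps ω n k ≤ failures ω k (leftSteps ω n (k + 1) + 1) := by
  have hf := rightSteps_sub_leftSteps ω n k
  by_cases hk : k < walk ω n
  · rw [leftSteps_of_lt_walk ω n hk]
    refine (h.1 k).failureCount_mono ?_
    split_ifs at hf <;> omega
  · refine ((h.1 k).sub_trues_le _).trans ((h.1 k).failureCount_mono ?_)
    change rightSteps ω n k + 1 ≤ _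
    split_ifs at hf <;> omega

lemma leftSteps_eq_failures (ω : Arrows) (n : ℕ) {k : ℤ} (hk : k < walk ω n) (hk0 : 0 ≤ k) :
    leftSteps ω n k = failures ω k (leftSteps ω n (k + 1) + 1) := by
  have hf := rightSteps_sub_leftSteps ω n k
  rw [leftSteps_of_lt_walk ω n hk]
  congr 1
  split_ifs at hf <;> omega

lemma Good.leftSteps_le_branching {ω : Arrows} (h : Good ω) (n m : ℕ) {k : ℤ}
    (hk : (n : ℤ) ≤ k + m) :
    leftSteps ω n k ≤ branching ω m k := by
  induction m generalizing k with
  | zero => rw [leftSteps_eq_zero_of_le ω (by simpa using hk)]; exact Nat.zero_le _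
  | succ m ih =>
    refine (h.leftSteps_le_failures n k).trans ?_
    exact (h.1 k).failureCount_mono (Nat.succ_le_succ (ih (by push_cast at hk; omega)))

lemma Good.leftSteps_le_branchingLim {ω : Arrows} (h : Good ω) (n : ℕ) (k : ℤ)
    : leftSteps ω n k ≤ branchingLim ω k :=
  (h.leftSteps_le_branching n (n - k).toNat (by omega)).trans (h.branching_le _ k)

lemma Good.le_walk {ω : Arrows} (h : Good ω) {x : ℤ} (hx0 : x ≤ 0) (hx : branchingLim ω x = 0)
    (n : ℕ) : x ≤ walk ω n := by
  have h1 := h.leftSteps_le_branchingLim n x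
  have hf := rightSteps_sub_leftSteps ω n (x - 1)
  rw [sub_add_cancel] at hf
  split_ifs at hf <;> omega

lemma Good.departures_le {ω : Arrows} (h : Good ω) (n : ℕ) (k : ℤ) : departures ω n k ≤
    branchingLim ω k + branchingLim ω (k + 1) + if k < 0 then 0 else 1 := by
  have h1 := h.leftSteps_le_branchingLim n k
  have h2 := h.leftSteps_le_branchingLim n (k + 1)
  have h3 := rightSteps_add_leftSteps ω n k
  have hf := rightSteps_sub_leftSteps ω n k
  split_ifs at hf ⊢ <;> omega

lemma Good.time_le {ω : Arrows} (h : Good ω) {a : ℕ} (ha : branchingLim ω (-a) = 0) {j : ℕ}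
    (hj : branchingLim ω j = 0)
    (hj0 : 0 < j) {t : ℕ} (ht : walk ω t < j) :
    t ≤ j + 2 * ∑ k ∈ Finset.range j, branchingLim ω k
      + 2 * ∑ i ∈ Finset.range a, branchingLim ω (i + -a) := by
  have hR : ∀ n, rightSteps ω n (j - 1) = if (j : ℤ) ≤ walk ω n then 1 else 0 := by
    intro n
    have h1 := h.leftSteps_le_branchingLim n j
    have hf := rightSteps_sub_leftSteps ω n (j - 1)
    rw [sub_add_cancel] at hf
    split_ifs at hf ⊢ <;> omega
  have hlt : ∀ m < t, walk ω m < j := by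
    intro m hm
    have h1 := rightSteps_mono ω (j - 1) hm.le
    simp only [hR] at h1
    split_ifs at h1 <;> omega
  have hsum := sum_departures_eq ω (a := -a) (N := a + j) (n := t) fun m hm =>
    ⟨h.le_walk (by omega) ha m, by have := hlt m hm; push_cast; omega⟩
  have hle : ∑ i ∈ Finset.range (a + j), departures ω t (i + -a) ≤
      ∑ i ∈ Finset.range (a + j), (branchingLim ω (i + -a) + branchingLim ω ((i + 1 : ℕ) + -a)
        + if i < a then 0 else 1) := by
    refine Finset.sum_le_sum fun i _ => (h.departures_le t _).trans_eq ?_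
    congr 2
    · congr 1; push_cast; ring
    · simp only [eq_iff_iff]; omega
  have hshift : ∑ i ∈ Finset.range (a + j), branchingLim ω ((i + 1 : ℕ) + -a) =
      ∑ i ∈ Finset.range (a + j), branchingLim ω (i + -a) := by
    have h1 := Finset.sum_range_succ (fun i : ℕ => branchingLim ω (i + -a)) (a + j)
    have h2 := Finset.sum_range_succ' (fun i : ℕ => branchingLim ω (i + -a)) (a + j)
    have e1 : ((a + j : ℕ) : ℤ) + -a = j := by push_cast; ring
    have e2 : ((0 : ℕ) : ℤ) + -(a : ℤ) = -a := by simp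
    rw [e1, hj] at h1
    rw [e2, ha] at h2
    omega
  have hind : ∑ i ∈ Finset.range (a + j), (if i < a then 0 else 1) = j := by
    rw [Finset.sum_range_add, Finset.sum_eq_zero fun i hi => if_pos (Finset.mem_range.1 hi)]
    simp
  have hsplit : ∑ i ∈ Finset.range (a + j), branchingLim ω (i + -a) =
      ∑ i ∈ Finset.range a, branchingLim ω (i + -a) + ∑ k ∈ Finset.range j, branchingLim ω k := by
    rw [Finset.sum_range_add]
    congr 1
    refine Finset.sum_congr rfl fun k _ => ?_
    congr 1
    push_cast
    ring
  rw [hsum, Finset.sum_add_distrib, Finset.sum_add_distrib, hshift, hind, hsplit] at hle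
  omega

lemma Good.le_time {ω : Arrows} (h : Good ω) {j : ℕ} (hj : branchingLim ω j = 0) {t : ℕ}
    (ht : (j : ℤ) ≤ walk ω t) :
    j + 2 * ∑ k ∈ Finset.range j, branchingLim ω k ≤ t + branchingLim ω 0 := by
  have hL : ∀ i k : ℕ, k + i = j → leftSteps ω t k = branchingLim ω k := by
    intro i
    induction i with
    | zero =>
      rintro k rfl
      have := h.leftSteps_le_branchingLim t k
      simp only [add_zero] at hj
      omega
    | succ i ih =>
      intro k hk
      rw [leftSteps_eq_failures ω t (by omega) (by omega), h.branchingLim_eq k]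
      have := ih (k + 1) (by omega)
      push_cast at this
      rw [this]
  have hsum := sum_departures_le ω 0 j t
  have heq : ∀ k ∈ Finset.range j, departures ω t (k + 0) =
      branchingLim ω k + branchingLim ω (k + 1 : ℕ) + 1 := by
    intro k hk
    rw [Finset.mem_range] at hk
    have h1 := hL (j - k) k (by omega)
    have h2 := hL (j - (k + 1)) (k + 1) (by omega)
    have h3 := rightSteps_add_leftSteps ω t k
    have hf := rightSteps_sub_leftSteps ω t k
    rw [add_zero]
    push_cast at h2 ⊢
    split_ifs at hf <;> omega
  rw [Finset.sum_congr rfl heq, Finset.sum_add_distrib, Finset.sum_add_distrib] at hsum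
  have h1 := Finset.sum_range_succ (fun i : ℕ => branchingLim ω i) j
  have h2 := Finset.sum_range_succ' (fun i : ℕ => branchingLim ω i) j
  simp only [Finset.sum_const, Finset.card_range, smul_eq_mul, mul_one] at hsum
  rw [Nat.cast_zero] at h2
  omega

/-- A path squeezed between the passage times `S j ± C` at a relatively dense set of levels `j`
has the speed given by the asymptotic slope of `S`. -/
lemma tendsto_speed_of_passage {X : ℕ → ℤ} {S : ℕ → ℝ} {J : Set ℕ} {v C : ℝ} {x₀ : ℤ}
    (hS : Tendsto (fun n : ℕ => (n : ℝ) / S n) atTop (𝓝 v)) (hS0 : ∀ n : ℕ, (n : ℝ) ≤ S n)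
    (hJ : ∀ ε > 0, ∀ᶠ n : ℕ in atTop, ∃ j ∈ J, n ≤ j ∧ (j : ℝ) ≤ (1 + ε) * n)
    (hlow : ∀ t, x₀ ≤ X t) (hle : ∀ j ∈ J, 0 < j → ∀ t, X t < j → t ≤ S j + C)
    (hge : ∀ j ∈ J, ∀ t, (j : ℤ) ≤ X t → S j ≤ t + C) :
    Tendsto (fun t : ℕ => (X t : ℝ) / t) atTop (𝓝 v) := by
  have hv : 0 ≤ v := ge_of_tendsto' hS fun n => div_nonneg n.cast_nonneg (n.cast_nonneg.trans (hS0 n))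
  have hlin : ∀ a b : ℝ, 0 < a → ∀ᶠ t : ℕ in atTop, b < a * t := fun a b ha =>
    (tendsto_natCast_atTop_atTop.const_mul_atTop ha).eventually_gt_atTop b
  rw [tendsto_order]
  constructor
  · intro c hc
    suffices hpos : ∀ c, 0 < c → c < v → ∀ᶠ t : ℕ in atTop, c < (X t : ℝ) / t by
      rcases hv.eq_or_lt with rfl | hv
      · filter_upwards [hlin (-c) (-x₀) (by linarith), eventually_gt_atTop 0] with t ht ht0
        have ht0' : (0 : ℝ) < t := by exact_mod_cast ht0
        have : (x₀ : ℝ) ≤ X t := by exact_mod_cast hlow t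
        rw [lt_div_iff₀ ht0']
        linarith
      · filter_upwards [hpos (max c (v / 2)) (lt_max_of_lt_right (by linarith))
          (max_lt hc (by linarith))] with t ht
        exact (le_max_left _ _).trans_lt ht
    clear hc c
    intro c hc0 hcv
    set d := (v + c) / 2 with hd
    have hcd : c < d := by linarith
    have hdv : d < v := by linarith
    set ε := (d - c) / (2 * c) with hε
    have hε0 : 0 < ε := div_pos (by linarith) (by linarith)
    have hεc : (1 + ε) * c = (c + d) / 2 := by rw [hε]; field_simp; ring
    have hm : Tendsto (fun t : ℕ => ⌊c * t⌋₊ + 1) atTop atTop :=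
      (tendsto_add_atTop_nat 1).comp (tendsto_nat_floor_atTop.comp
        (tendsto_natCast_atTop_atTop.const_mul_atTop hc0))
    obtain ⟨N, hN⟩ := eventually_atTop.1 ((tendsto_order.1 hS).1 d hdv)
    filter_upwards [hm.eventually (hJ ε hε0), hm.eventually_ge_atTop N,
      hlin ((d - c) / 2) (1 + ε + d * C) (by linarith), eventually_gt_atTop 0]
      with t ⟨j, hjJ, hj1, hj2⟩ ht1 ht2 ht0
    have ht0' : (0 : ℝ) < t := by exact_mod_cast ht0
    rw [lt_div_iff₀ ht0']
    by_contra! hX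
    have hfl : (⌊c * t⌋₊ : ℝ) ≤ c * t := Nat.floor_le (by positivity)
    have hfl2 : c * t < (⌊c * t⌋₊ + 1 : ℕ) := by push_cast; exact Nat.lt_floor_add_one _
    have hj1' : ((⌊c * t⌋₊ + 1 : ℕ) : ℝ) ≤ j := by exact_mod_cast hj1
    have hXj : X t < j := by
      have : (X t : ℝ) < j := by linarith
      exact_mod_cast this
    have h1 := hle j hjJ (by omega) t hXj
    have hj0 : (0 : ℝ) < j := by
      have : 0 < j := by omega
      exact_mod_cast this
    have h2 := hN j (ht1.trans hj1)
    rw [lt_div_iff₀ (hj0.trans_le (hS0 j))] at h2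
    push_cast at hj2
    have h3 : (1 + ε) * (⌊c * t⌋₊ + 1 : ℝ) ≤ (1 + ε) * (c * t + 1) := by gcongr
    have h4 : d * t ≤ d * (S j + C) := mul_le_mul_of_nonneg_left h1 (by linarith)
    have h5 : (1 + ε) * (c * t + 1) = (c + d) / 2 * t + (1 + ε) := by rw [← hεc]; ring
    linarith
  · intro c hc
    set d := (v + c) / 2 with hd
    have hvd : v < d := by linarith
    have hdc : d < c := by linarith
    have hd0 : 0 < d := by linarith
    set ε := (c - d) / (2 * d) with hε
    have hε0 : 0 < ε := div_pos (by linarith) (by linarith)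
    have hεd : (1 + ε) * d = (c + d) / 2 := by rw [hε]; field_simp; ring
    have hm : Tendsto (fun t : ℕ => ⌊c * t / (1 + ε)⌋₊) atTop atTop :=
      tendsto_nat_floor_atTop.comp
        ((tendsto_natCast_atTop_atTop.const_mul_atTop (by linarith)).atTop_div_const (by linarith))
    obtain ⟨N, hN⟩ := eventually_atTop.1 ((tendsto_order.1 hS).2 d hvd)
    filter_upwards [hm.eventually (hJ ε hε0), hm.eventually_ge_atTop (max N 1),
      hlin ((c - d) / 2) ((1 + ε) * (1 + d * C)) (by linarith), eventually_gt_atTop 0]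
      with t ⟨j, hjJ, hj1, hj2⟩ ht1 ht2 ht0
    have ht0' : (0 : ℝ) < t := by exact_mod_cast ht0
    rw [div_lt_iff₀ ht0']
    by_contra! hX
    have hfl : (⌊c * t / (1 + ε)⌋₊ : ℝ) ≤ c * t / (1 + ε) :=
      Nat.floor_le (div_nonneg (mul_nonneg (by linarith) ht0'.le) (by linarith))
    have hfl2 : c * t / (1 + ε) < ⌊c * t / (1 + ε)⌋₊ + 1 := Nat.lt_floor_add_one _
    have hj1' : (⌊c * t / (1 + ε)⌋₊ : ℝ) ≤ j := by exact_mod_cast hj1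
    have hXj : (j : ℤ) ≤ X t := by
      have h3 : (1 + ε) * (⌊c * t / (1 + ε)⌋₊ : ℝ) ≤ (1 + ε) * (c * t / (1 + ε)) := by gcongr
      rw [mul_div_cancel₀ _ (by linarith)] at h3
      have : (j : ℝ) ≤ X t := by linarith
      exact_mod_cast this
    have h1 := hge j hjJ t hXj
    have hj0 : (0 : ℝ) < j := by
      have : 0 < j := (le_max_right N 1).trans (ht1.trans hj1)
      exact_mod_cast this
    have h2 := hN j ((le_max_left N 1).trans (ht1.trans hj1))
    rw [div_lt_iff₀ (hj0.trans_le (hS0 j))] at h2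
    have h4 : d * S j ≤ d * (t + C) := mul_le_mul_of_nonneg_left h1 hd0.le
    have h5 : c * t / (1 + ε) < d * (t + C) + 1 := by linarith
    rw [div_lt_iff₀ (by linarith)] at h5
    have h6 : (d * (t + C) + 1) * (1 + ε) = (1 + ε) * d * t + (1 + ε) * (1 + d * C) := by ring
    rw [h6, hεd] at h5
    linarith

lemma ae_tendsto_walk {q : ℕ → ℝ} {M : ℕ} {π : ℕ → ℝ} (hq : ∀ j, q j ∈ Set.Ioo (0 : ℝ) 1)
    (hM : ∀ j, M ≤ j → q j = 1 / 2) (h : IsStationaryDist q π) :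
    ∀ᵐ ω ∂arrowMeasure q, Tendsto (fun n : ℕ => (walk ω n : ℝ) / n) atTop
      (𝓝 (((1 : ℝ≥0∞) + 2 * (∑' k : ℕ, (k : ℝ≥0∞) * ENNReal.ofReal (π k)))⁻¹.toReal)) := by
  filter_upwards [ae_good hq hM h, ae_tendsto_speed hq hM h, ae_tendsto_zeros hq hM h,
    ae_exists_zero_nonpos hq hM h] with ω hω hspeed hzeros ⟨x₀, hx₀, hx0⟩
  obtain ⟨a, rfl⟩ : ∃ a : ℕ, x₀ = -(a : ℤ) := ⟨x₀.natAbs, by omega⟩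
  refine tendsto_speed_of_passage (J := {j | branchingLim ω j = 0}) (x₀ := -a)
    (C := 2 * ∑ i ∈ Finset.range a, branchingLim ω (i + -a) + branchingLim ω 0) hspeed
    (fun n => ?_) (fun ε hε => ?_) (hω.le_walk hx₀ hx0) ?_ ?_
  · have : (0 : ℝ) ≤ ∑ k ∈ Finset.range n, (branchingLim ω k : ℝ) :=
      Finset.sum_nonneg fun _ _ => Nat.cast_nonneg _
    linarith
  · exact exists_zero_between (Z := fun k => branchingLim ω k) (h.pos hq hM 0) hzeros hε
  · intro j hj hj0 t ht
    have := hω.time_le hx0 hj hj0 ht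
    have h2 : (t : ℝ) ≤ (j + 2 * ∑ k ∈ Finset.range j, branchingLim ω k
      + 2 * ∑ i ∈ Finset.range a, branchingLim ω (i + -a) : ℕ) := by exact_mod_cast this
    push_cast at h2
    have : (0 : ℝ) ≤ branchingLim ω 0 := Nat.cast_nonneg _
    push_cast
    linarith
  · intro j hj t ht
    have := hω.le_time hj ht
    have h2 : ((j + 2 * ∑ k ∈ Finset.range j, branchingLim ω k : ℕ) : ℝ) ≤
      (t + branchingLim ω 0 : ℕ) := by exact_mod_cast this
    push_cast at h2
    have : (0 : ℝ) ≤ ∑ i ∈ Finset.range a, (branchingLim ω (i + -a) : ℝ) :=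
      Finset.sum_nonneg fun _ _ => Nat.cast_nonneg _
    push_cast
    linarith

lemma departures_eq_count (ω : Arrows) (n : ℕ) (x : ℤ) :
    departures ω n x = Nat.count (fun m => walk ω m = x) n := by
  induction n with
  | zero => simp [departures_zero]
  | succ n ih => rw [departures_succ, Nat.count_succ, ih]; simp only [eq_comm]

lemma measurable_walk_departures (n : ℕ) :
    Measurable (fun ω => walk ω n) ∧ ∀ x, Measurable fun ω => departures ω n x := by
  induction n with
  | zero => exact ⟨measurable_const, fun _ => measurable_const⟩
  | succ n ih =>
    obtain ⟨h1, h2⟩ := ih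
    have h3 : Measurable fun ω => departures ω n (walk ω n) :=
      (measurable_from_prod_countable_left (f := fun a : Arrows × ℤ => departures a.1 n a.2) h2).comp
        (measurable_id.prodMk h1)
    have h4 : Measurable fun ω : Arrows => ω (walk ω n, departures ω n (walk ω n)) :=
      (measurable_from_prod_countable_left (f := fun a : Arrows × (ℤ × ℕ) => a.1 a.2)
        fun a => measurable_pi_apply (X := fun _ => Bool) a).comp
        (measurable_id.prodMk (h1.prodMk h3))
    refine ⟨?_, fun x => ?_⟩
    · simp only [walk_succ]
      exact h1.add ((Measurable.of_discrete (f := fun b : Bool => if b then (1 : ℤ) else -1)).comp h4)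
    · simp only [departures_succ]
      exact (h2 x).add ((Measurable.of_discrete (f := fun y : ℤ => if x = y then 1 else 0)).comp h1)

lemma measurable_walk (n : ℕ) : Measurable fun ω => walk ω n := (measurable_walk_departures n).1

/-- The event that the walk follows the path `w` up to time `n`. -/
def pathEvent (w : ℕ → ℤ) (n : ℕ) : Set Arrows := {ω | ∀ m ≤ n, walk ω m = w m}

lemma measurableSet_pathEvent (w : ℕ → ℤ) (n : ℕ) : MeasurableSet (pathEvent w n) := by
  simp only [pathEvent, Set.ofPred_forall]
  exact .iInter fun m => .iInter fun _ => measurable_walk m (measurableSet_singleton _)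

lemma departures_of_mem_pathEvent {w : ℕ → ℤ} {n m : ℕ} {ω : Arrows} (h : ω ∈ pathEvent w n)
    (hm : m ≤ n) (x : ℤ) : departures ω m x = Nat.count (fun i => w i = x) m := by
  rw [departures_eq_count, Nat.count_eq_card_filter_range, Nat.count_eq_card_filter_range]
  congr 1
  refine Finset.filter_congr fun i hi => ?_
  rw [h i ((Finset.mem_range.1 hi).le.trans hm)]

lemma dependsOn_pathEvent (w : ℕ → ℤ) (n : ℕ) :
    DependsOn (· ∈ pathEvent w n) {a : ℤ × ℕ | a.2 < Nat.count (fun i => w i = a.1) n} := by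
  have key : ∀ ω ω' : Arrows, (∀ a ∈ {a : ℤ × ℕ | a.2 < Nat.count (fun i => w i = a.1) n},
      ω a = ω' a) → ω ∈ pathEvent w n → ω' ∈ pathEvent w n := by
    intro ω ω' h hω m
    induction m using Nat.strong_induction_on with
    | _ m ih =>
      intro hm
      cases m with
      | zero => exact hω 0 hm
      | succ m =>
        have hω' : ω' ∈ pathEvent w m := fun i hi => ih i (by omega) (by omega)
        rw [← hω _ hm, walk_succ, walk_succ, hω' m le_rfl, hω m (by omega),
          departures_of_mem_pathEvent hω' le_rfl, departures_of_mem_pathEvent hω (by omega),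
          h _ (Nat.count_strict_mono (p := fun i => w i = w m) rfl (by omega))]
  intro ω ω' h
  exact propext ⟨key ω ω' h, key ω' ω fun a ha => (h a ha).symm⟩

lemma arrowMeasure_pathEvent_inter_step {q : ℕ → ℝ} (hq : ∀ j, q j ∈ Set.Ioo (0 : ℝ) 1)
    (w : ℕ → ℤ) (n : ℕ) :
    arrowMeasure q ({ω | walk ω (n + 1) = w n + 1} ∩ pathEvent w n) =
      ENNReal.ofReal (q (Nat.count (fun i => w i = w n) n)) * arrowMeasure q (pathEvent w n) := by
  set a : ℤ × ℕ := (w n, Nat.count (fun i => w i = w n) n) with ha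
  have h1 : {ω | walk ω (n + 1) = w n + 1} ∩ pathEvent w n = {ω | ω a = true} ∩ pathEvent w n := by
    ext ω
    refine and_congr_left fun hω => ?_
    change walk ω (n + 1) = w n + 1 ↔ ω a = true
    rw [walk_succ, hω n le_rfl, departures_of_mem_pathEvent hω le_rfl, ← ha]
    cases ω a <;> simp
  have hdep : DependsOn (· ∈ {ω : Arrows | ω a = true}) {a} := by
    intro ω ω' h
    change (ω a = true) = (ω' a = true)
    rw [h a rfl]
  rw [h1, arrowMeasure_inter q (measurableSet_arrow _ _) (measurableSet_pathEvent w n) hdep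
    (dependsOn_pathEvent w n) (by simp [ha]), arrowMeasure_arrow hq, if_pos rfl]

lemma card_filter_eq_last (w : ℕ → ℤ) (n : ℕ) :
    (Finset.univ.filter fun m : Fin (n + 1) => w m = w (Fin.last n)).card - 1 =
      Nat.count (fun i => w i = w n) n := by
  simp only [Fin.val_last]
  rw [Finset.card_filter, Fin.sum_univ_eq_sum_range (fun m => if w m = w n then 1 else 0) (n + 1),
    Finset.sum_range_succ, if_pos rfl, Nat.add_sub_cancel, Nat.count_eq_card_filter_range,
    Finset.card_filter]

lemma cookieSeq_mem_Ioo {M : ℕ} {p : Fin M → ℝ} {p₀ : ℝ} (hp : ∀ i, p i ∈ Set.Ioo (0 : ℝ) 1)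
    (hp₀ : p₀ ∈ Set.Ioo (0 : ℝ) 1) (j : ℕ) : cookieSeq M p p₀ j ∈ Set.Ioo (0 : ℝ) 1 := by
  unfold cookieSeq
  split_ifs
  exacts [hp _, hp₀]

lemma cookieSeq_of_le {M : ℕ} (p : Fin M → ℝ) (p₀ : ℝ) {j : ℕ} (h : M ≤ j) :
    cookieSeq M p p₀ j = p₀ := dif_neg h.not_gt

lemma sum_cookieSeq {M : ℕ} (p : Fin M → ℝ) (p₀ : ℝ) :
    ∑ j ∈ Finset.range M, (2 * cookieSeq M p p₀ j - 1) = ∑ i, (2 * p i - 1) := by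
  rw [← Fin.sum_univ_eq_sum_range (fun j => 2 * cookieSeq M p p₀ j - 1)]
  exact Finset.sum_congr rfl fun i _ => by rw [cookieSeq, dif_pos i.2]

/-- A path of length `n + 1`, extended by zero. -/
def extendPath {n : ℕ} (w : Fin (n + 1) → ℤ) (m : ℕ) : ℤ := if h : m < n + 1 then w ⟨m, h⟩ else 0

lemma extendPath_val {n : ℕ} (w : Fin (n + 1) → ℤ) (m : Fin (n + 1)) : extendPath w m = w m :=
  dif_pos m.2

lemma isEARW_walk {M : ℕ} {p : Fin M → ℝ} {p₀ : ℝ} (hp : ∀ i, p i ∈ Set.Ioo (0 : ℝ) 1)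
    (hp₀ : p₀ ∈ Set.Ioo (0 : ℝ) 1) :
    IsEARW (arrowMeasure (cookieSeq M p p₀)) M p p₀ (fun n ω => walk ω n) where
  measurable := measurable_walk
  init := walk_zero
  steps ω n := by rw [walk_succ, add_sub_cancel_left]; split_ifs <;> rfl
  cond n w := by
    have h1 : {ω : Arrows | ∀ m : Fin (n + 1), walk ω m = w m} = pathEvent (extendPath w) n := by
      ext ω
      refine ⟨fun h m hm => ?_, fun h m => ?_⟩
      · exact (h ⟨m, by omega⟩).trans (extendPath_val w ⟨m, by omega⟩).symm
      · exact (h m (by omega)).trans (extendPath_val w m)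
    have h2 := arrowMeasure_pathEvent_inter_step (cookieSeq_mem_Ioo hp hp₀) (extendPath w) n
    rw [← card_filter_eq_last] at h2
    simp only [extendPath_val] at h2
    rw [h1, ← h2, ← extendPath_val w (Fin.last n)]
    rfl

/-- Laws on path space are determined by the probabilities of initial segments. -/
lemma ext_of_initial_segment {μ ν : Measure (ℕ → ℤ)} [IsFiniteMeasure μ] [IsFiniteMeasure ν]
    (h : ∀ (n : ℕ) (w : Fin (n + 1) → ℤ),
      μ {x | ∀ m : Fin (n + 1), x m = w m} = ν {x | ∀ m : Fin (n + 1), x m = w m}) : μ = ν := by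
  have hν : IsProjectiveLimit ν fun I : Finset ℕ => ν.map I.restrict := fun I => rfl
  have hfam : IsProjectiveMeasureFamily fun I : Finset ℕ => ν.map I.restrict := by
    intro I J hJI
    rw [Measure.map_map (Finset.measurable_restrict₂ hJI) (Finset.measurable_restrict I)]
    rfl
  refine IsProjectiveLimit.unique ((isProjectiveLimit_nat_iff hfam μ).2 fun n => ?_) hν
  refine Measure.ext_of_singleton fun w => ?_
  have hset : (Finset.Iic n).restrict (π := fun _ => ℤ) ⁻¹' {w} =
      {x : ℕ → ℤ | ∀ m : Fin (n + 1), x m = w ⟨m, Finset.mem_Iic.2 (by omega)⟩} := by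
    ext x
    refine ⟨fun hx m => congrFun hx ⟨m, Finset.mem_Iic.2 (by omega)⟩, fun hx => funext fun m => ?_⟩
    exact hx ⟨m, Nat.lt_succ_of_le (Finset.mem_Iic.1 m.2)⟩
  change μ.map (Finset.Iic n).restrict {w} = ν.map (Finset.Iic n).restrict {w}
  rw [Measure.map_apply (Finset.measurable_restrict _) (measurableSet_singleton _),
    Measure.map_apply (Finset.measurable_restrict _) (measurableSet_singleton _), hset, h]

section
variable {Ω Ω' : Type*} [MeasurableSpace Ω] [MeasurableSpace Ω'] {P : Measure Ω} {P' : Measure Ω'}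
  {M : ℕ} {p : Fin M → ℝ} {p₀ : ℝ} {X : ℕ → Ω → ℤ} {X' : ℕ → Ω' → ℤ}

lemma IsEARW.measurableSet_path (hX : IsEARW P M p p₀ X) {n : ℕ} (w : Fin n → ℤ) :
    MeasurableSet {ω | ∀ m : Fin n, X m ω = w m} := by
  simp only [Set.ofPred_forall]
  exact .iInter fun m => hX.measurable m (measurableSet_singleton _)

variable [IsProbabilityMeasure P] [IsProbabilityMeasure P']

lemma IsEARW.path_succ_eq (hX : IsEARW P M p p₀ X) {n : ℕ} (w : Fin (n + 2) → ℤ) :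
    P {ω | ∀ m : Fin (n + 2), X m ω = w m} =
      if w (Fin.last _) = w (Fin.last n).castSucc + 1 then
        P ({ω | X (n + 1) ω = w (Fin.last n).castSucc + 1} ∩
          {ω | ∀ m : Fin (n + 1), X m ω = w m.castSucc})
      else if w (Fin.last _) = w (Fin.last n).castSucc - 1 then
        P {ω | ∀ m : Fin (n + 1), X m ω = w m.castSucc} -
          P ({ω | X (n + 1) ω = w (Fin.last n).castSucc + 1} ∩
            {ω | ∀ m : Fin (n + 1), X m ω = w m.castSucc})
      else 0 := by
  have hset : {ω | ∀ m : Fin (n + 2), X m ω = w m} = {ω | X (n + 1) ω = w (Fin.last _)} ∩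
      {ω | ∀ m : Fin (n + 1), X m ω = w m.castSucc} := by
    ext ω
    simp only [Set.mem_ofPred_eq, Set.mem_inter_iff, Fin.forall_fin_succ' (n := n + 1), Fin.val_last,
      Fin.val_castSucc]
    exact and_comm
  have hstep : ∀ ω ∈ {ω | ∀ m : Fin (n + 1), X m ω = w m.castSucc},
      X (n + 1) ω = w (Fin.last n).castSucc + 1 ∨ X (n + 1) ω = w (Fin.last n).castSucc - 1 := by
    intro ω hω
    have h1 : X n ω = w (Fin.last n).castSucc := hω (Fin.last n)
    have h2 := hX.steps ω n
    rw [abs_eq one_pos.le] at h2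
    omega
  rw [hset]
  split_ifs with h1 h2
  · rw [h1]
  · rw [← measure_sdiff Set.inter_subset_right ?_ (measure_ne_top _ _)]
    · congr 1
      ext ω
      simp only [Set.mem_ofPred_eq, Set.mem_inter_iff, Set.mem_sdiff, h2]
      refine ⟨fun h => ⟨h.2, fun h' => by omega⟩, fun h => ⟨?_, h.1⟩⟩
      have := hstep ω h.1
      tauto
    · exact ((hX.measurable _ (measurableSet_singleton _)).inter
        (hX.measurableSet_path _)).nullMeasurableSet
  · rw [← measure_empty (μ := P)]
    congr 1
    ext ω
    simp only [Set.mem_ofPred_eq, Set.mem_inter_iff, Set.mem_empty_iff_false, iff_false]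
    rintro ⟨h3, h4⟩
    rcases hstep ω h4 <;> omega

lemma IsEARW.path_eq (hX : IsEARW P M p p₀ X) (hX' : IsEARW P' M p p₀ X') (n : ℕ)
    (w : Fin (n + 1) → ℤ) :
    P {ω | ∀ m : Fin (n + 1), X m ω = w m} = P' {ω | ∀ m : Fin (n + 1), X' m ω = w m} := by
  induction n with
  | zero =>
    by_cases h : 0 = w 0 <;> simp [h, hX.init, hX'.init]
  | succ n ih =>
    have h1 := hX.cond n (fun m => w m.castSucc)
    have h2 := hX'.cond n (fun m => w m.castSucc)
    rw [ih] at h1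
    rw [hX.path_succ_eq, hX'.path_succ_eq, h1, h2, ih]

lemma IsEARW.map_eq (hX : IsEARW P M p p₀ X) (hX' : IsEARW P' M p p₀ X') :
    P.map (fun ω n => X n ω) = P'.map (fun ω n => X' n ω) := by
  have hm : Measurable fun ω n => X n ω := measurable_pi_lambda _ hX.measurable
  have hm' : Measurable fun ω n => X' n ω := measurable_pi_lambda _ hX'.measurable
  have := Measure.isProbabilityMeasure_map (μ := P) hm.aemeasurable
  have := Measure.isProbabilityMeasure_map (μ := P') hm'.aemeasurable
  refine ext_of_initial_segment fun n w => ?_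
  have hs : MeasurableSet {x : ℕ → ℤ | ∀ m : Fin (n + 1), x m = w m} := by
    simp only [Set.ofPred_forall]
    exact .iInter fun m => measurable_pi_apply (X := fun _ : ℕ => ℤ) m (measurableSet_singleton _)
  rw [Measure.map_apply hm hs, Measure.map_apply hm' hs]
  exact hX.path_eq hX' n w

lemma IsEARW.ae_tendsto_div (hX : IsEARW P M p p₀ X) (hX' : IsEARW P' M p p₀ X') {v : ℝ}
    (h : ∀ᵐ ω ∂P', Tendsto (fun n : ℕ => (X' n ω : ℝ) / n) atTop (𝓝 v)) :
    ∀ᵐ ω ∂P, Tendsto (fun n : ℕ => (X n ω : ℝ) / n) atTop (𝓝 v) := by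
  have hs : MeasurableSet {x : ℕ → ℤ | Tendsto (fun n : ℕ => (x n : ℝ) / n) atTop (𝓝 v)} :=
    measurableSet_tendsto _ fun n =>
      ((Measurable.of_discrete (f := fun z : ℤ => (z : ℝ))).comp
        (measurable_pi_apply (X := fun _ : ℕ => ℤ) n)).div_const _
  have h2 := (ae_map_iff (measurable_pi_lambda _ hX'.measurable).aemeasurable hs).2 h
  rw [← hX.map_eq hX'] at h2
  exact (ae_map_iff (measurable_pi_lambda _ hX.measurable).aemeasurable hs).1 h2

end

/-- **Basdevant–Singh: stationary distribution and speed formula.**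
For a standard excited random walk (`p₀ = 1/2`) with `M` cookies and cookie vector `p`:
(i) the associated backwards branching-like process has a stationary distribution iff
`δ(M,p) > 1`; (ii) if `δ(M,p) > 1`, then a.s. `Y n / n → 1 / (1 + 2 ∑ k, k π k)`, with
the convention `1/∞ = 0` (the mean is computed in `ℝ≥0∞`). -/
theorem excited_rw_speed_formula
    {Ω : Type*} [MeasurableSpace Ω] (P : Measure Ω) [IsProbabilityMeasure P]
    (M : ℕ) (hM : 1 ≤ M) (p : Fin M → ℝ) (hp : ∀ i, p i ∈ Set.Ioo (0 : ℝ) 1)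
    (Y : ℕ → Ω → ℤ) (hY : IsEARW P M p (1 / 2) Y) :
    ((∃ π : ℕ → ℝ, IsStationaryDist (cookieSeq M p (1 / 2)) π)
        ↔ 1 < ∑ i, (2 * p i - 1))
    ∧ (1 < ∑ i, (2 * p i - 1) →
        ∀ π : ℕ → ℝ, IsStationaryDist (cookieSeq M p (1 / 2)) π →
          ∀ᵐ ω ∂P,
            Tendsto (fun n : ℕ => (Y n ω : ℝ) / n) atTop
              (nhds
                (((1 : ℝ≥0∞)
                    + 2 * (∑' k : ℕ, (k : ℝ≥0∞) * ENNReal.ofReal (π k)))⁻¹.toReal))) := by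
  have hhalf : (1 / 2 : ℝ) ∈ Set.Ioo (0 : ℝ) 1 := by norm_num
  have hq := cookieSeq_mem_Ioo hp hhalf
  have hqM : ∀ j, M ≤ j → cookieSeq M p (1 / 2) j = 1 / 2 := fun j => cookieSeq_of_le p _
  rw [← sum_cookieSeq p (1 / 2)]
  exact ⟨⟨fun ⟨_, h⟩ => h.one_lt_drift hq hqM, exists_isStationaryDist hq hqM⟩,
    fun _ π h => hY.ae_tendsto_div (isEARW_walk hp hhalf) (ae_tendsto_walk hq hqM h)⟩
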